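/- arXiv:1710.02981 — 3 statements merged into one kernel-verified Lean document; each statement's English description precedes it below -/
import Mathlib

section
/- Let 1 ≤ p < ∞ and 0 < ε < α ≤ 1. There exists a bounded linear operator T on ℓ^p(ℕ) such that T is absolutely (C,α)-Cesàro bounded, T is topologically mixing, and ‖T^n‖ = (n+1)^{(α−ε)/p} for all n ∈ ℕ₀. -/
open Filter
open scoped ENNReal

/-- The Cesàro kernel of order `α`: `k^α(n) = Γ(α+n) / (Γ(α)·Γ(n+1))`. -/
noncomputable def cesKernel (α : ℝ) (n : ℕ) : ℝ :=
  Real.Gamma (α + n) / (Real.Gamma α * Real.Gamma (n + 1))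

/-- A bounded linear operator `T` on a complex Banach space is absolutely `(C,α)`-Cesàro
bounded if there is `C > 0` with
`(1/k^{α+1}(n)) · Σ_{j=0}^n k^α(n-j) ‖T^j x‖ ≤ C ‖x‖` for all `n` and `x`. -/
def AbsCesaroBounded {X : Type*} [NormedAddCommGroup X] [NormedSpace ℂ X]
    (α : ℝ) (T : X →L[ℂ] X) : Prop :=
  ∃ C : ℝ, 0 < C ∧ ∀ (n : ℕ) (x : X),
    (cesKernel (α + 1) n)⁻¹ *
      ∑ j ∈ Finset.range (n + 1), cesKernel α (n - j) * ‖(T ^ j) x‖ ≤ C * ‖x‖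

/-- The Cesàro mean of order `α` of `T`:
`M_T^α(n) = (1/k^{α+1}(n)) · Σ_{j=0}^n k^α(n-j) T^j`. -/
noncomputable def cesMean {X : Type*} [NormedAddCommGroup X] [NormedSpace ℂ X]
    (α : ℝ) (T : X →L[ℂ] X) (n : ℕ) : X →L[ℂ] X :=
  (((cesKernel (α + 1) n)⁻¹ : ℝ) : ℂ) •
    ∑ j ∈ Finset.range (n + 1), ((cesKernel α (n - j) : ℝ) : ℂ) • T ^ j

/-- `T` is topologically mixing if for all non-empty open sets `U, V` there is `n₀` with
`T^n(U) ∩ V ≠ ∅` for all `n ≥ n₀`. -/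
def TopologicallyMixing {X : Type*} [NormedAddCommGroup X] [NormedSpace ℂ X]
    (T : X →L[ℂ] X) : Prop :=
  ∀ U V : Set X, IsOpen U → IsOpen V → U.Nonempty → V.Nonempty →
    ∃ n₀ : ℕ, ∀ n : ℕ, n ≥ n₀ → ((⇑(T ^ n)) '' U ∩ V).Nonempty

lemma ck_zero {α : ℝ} (h : 0 < α) : cesKernel α 0 = 1 := by
  have := (Real.Gamma_pos_of_pos h).ne'
  simp [cesKernel, this]

lemma ck_succ {α : ℝ} (h : 0 < α) (n : ℕ) :
    cesKernel α (n+1) = cesKernel α n * ((α + n) / (n + 1)) := by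
  have h1 := (Real.Gamma_pos_of_pos h).ne'
  have h2 : (α + n) ≠ 0 := by positivity
  have h3 : ((n:ℝ) + 1) ≠ 0 := by positivity
  have h4 := (Real.Gamma_pos_of_pos (by positivity : (0:ℝ) < n + 1)).ne'
  unfold cesKernel
  push_cast
  rw [← add_assoc, Real.Gamma_add_one h2, Real.Gamma_add_one h3]
  field_simp

lemma ck_pos {α : ℝ} (h : 0 < α) (n : ℕ) : 0 < cesKernel α n := by
  have h1 := (Real.Gamma_pos_of_pos h)
  have h2 := (Real.Gamma_pos_of_pos (by positivity : (0:ℝ) < α + n))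
  have h4 := (Real.Gamma_pos_of_pos (by positivity : (0:ℝ) < n + 1))
  unfold cesKernel
  positivity

lemma ck_rel {α : ℝ} (h : 0 < α) (n : ℕ) :
    cesKernel (α+1) n = cesKernel α n * ((α + n) / α) := by
  have h1 := (Real.Gamma_pos_of_pos h).ne'
  have h2 : (α + n) ≠ 0 := by positivity
  have h4 := (Real.Gamma_pos_of_pos (by positivity : (0:ℝ) < n + 1)).ne'
  unfold cesKernel
  rw [show α + 1 + n = (α + n) + 1 by ring, Real.Gamma_add_one h2, Real.Gamma_add_one h.ne']
  field_simp

lemma ck_sum {α : ℝ} (h : 0 < α) (n : ℕ) :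
    ∑ j ∈ Finset.range (n+1), cesKernel α j = cesKernel (α+1) n := by
  induction n with
  | zero => simp [ck_zero h, ck_zero (by linarith : 0 < α + 1)]
  | succ n ih =>
    rw [Finset.sum_range_succ, ih, ck_rel h, ck_rel h, ck_succ h]
    push_cast
    field_simp
    ring

lemma ck_lower {α : ℝ} (h : 0 < α) (h1 : α ≤ 1) (n : ℕ) :
    ((n:ℝ)+1) ^ α ≤ cesKernel (α+1) n := by
  induction n with
  | zero => simp [ck_zero (by linarith : 0 < α + 1)]
  | succ n ih =>
    rw [ck_succ (by linarith)]
    have hb := rpow_one_add_le_one_add_mul_self (s := 1 / ((n:ℝ)+1)) (p := α)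
      (le_trans (by norm_num) (by positivity : (0:ℝ) ≤ 1 / ((n:ℝ)+1))) h.le h1
    have e : ((n+1:ℕ):ℝ) + 1 = ((n:ℝ)+1) * (1 + 1/((n:ℝ)+1)) := by
      push_cast; field_simp
    rw [e, Real.mul_rpow (by positivity) (by positivity)]
    refine mul_le_mul ih (hb.trans (le_of_eq ?_)) (by positivity) (ck_pos (by linarith) _).le
    field_simp; ring

lemma ck_upper {α : ℝ} (h : 0 < α) (h1 : α ≤ 1) (n : ℕ) :
    cesKernel α n ≤ ((n:ℝ)+1) ^ (α-1) := by
  induction n with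
  | zero => simp [ck_zero h]
  | succ n ih =>
    rw [ck_succ h]
    have hb := rpow_one_add_le_one_add_mul_self (s := 1 / ((n:ℝ)+1)) (p := 1 - α)
      (le_trans (by norm_num) (by positivity : (0:ℝ) ≤ 1 / ((n:ℝ)+1))) (by linarith) (by linarith)
    have e : ((n+1:ℕ):ℝ) + 1 = ((n:ℝ)+1) * (1 + 1/((n:ℝ)+1)) := by
      push_cast; field_simp
    rw [e, Real.mul_rpow (by positivity) (by positivity)]
    refine mul_le_mul ih ?_ (by positivity) (by positivity)
    rw [show α - 1 = -(1-α) by ring, Real.rpow_neg (by positivity)]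
    have hp : 0 < (1 + 1/((n:ℝ)+1)) ^ (1-α) := by positivity
    rw [le_inv_comm₀ (by positivity) hp]
    refine hb.trans ?_
    rw [inv_div, show 1 + (1-α) * (1/((n:ℝ)+1)) = (n + 2 - α)/(n+1) by field_simp; ring,
      div_le_div_iff₀ (by positivity) (by positivity)]
    nlinarith [sq_nonneg (1-α)]

lemma sum_pow {ε : ℝ} (h : 0 < ε) (h1 : ε ≤ 1) (r : ℕ) :
    ∑ i ∈ Finset.range (r+1), ((i:ℝ)+1) ^ (ε-1) ≤ ((r:ℝ)+1)^ε / ε := by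
  induction r with
  | zero => simp; exact (one_le_inv₀ h).2 h1
  | succ r ih =>
    rw [Finset.sum_range_succ]
    refine (add_le_add_left ih _).trans ?_
    push_cast
    have y0 : (0:ℝ) < (r:ℝ)+1+1 := by positivity
    have hs : -1 ≤ -(1 / ((r:ℝ)+1+1)) := by
      rw [neg_le_neg_iff, div_le_one y0]; linarith [(Nat.cast_nonneg r : (0:ℝ) ≤ r)]
    have hb := rpow_one_add_le_one_add_mul_self hs h.le h1
    have e : (r:ℝ)+1 = ((r:ℝ)+1+1) * (1 + -(1/((r:ℝ)+1+1))) := by field_simp; ring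
    have e2 : ((r:ℝ)+1)^ε ≤ ((r:ℝ)+1+1)^ε * (1 + ε * -(1/((r:ℝ)+1+1))) := by
      conv_lhs => rw [e]
      rw [Real.mul_rpow y0.le (by linarith)]
      gcongr
    rw [Real.rpow_sub_one y0.ne']
    have : ((r:ℝ)+1)^ε / ε ≤ ((r:ℝ)+1+1)^ε * (1 + ε * -(1/((r:ℝ)+1+1))) / ε := by gcongr
    refine (add_le_add_left this _).trans (le_of_eq ?_)
    field_simp
    ring

/-- key estimate -/
lemma key {α ε : ℝ} (h0 : 0 < ε) (h : ε < α) (h1 : α ≤ 1) (m n : ℕ) :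
    ∑ j ∈ Finset.range (n+1), cesKernel α (n-j) *
      (if j ≤ m then (((m:ℝ)+1)/((m:ℝ)-j+1))^(α-ε) else 0) ≤ (2/ε) * cesKernel (α+1) n := by
  have hα : 0 < α := h0.trans h
  have hγ1 : α - ε ≤ 1 := by linarith
  have hγ0 : 0 ≤ α - ε := by linarith
  have h2ε : 2 ≤ 2/ε := by rw [le_div_iff₀ h0]; nlinarith
  have two : ∀ x : ℝ, 0 ≤ x → x ≤ 2 → x ^ (α-ε) ≤ 2 := fun x hx hx2 => by
    calc x ^ (α-ε) ≤ 2 ^ (α-ε) := Real.rpow_le_rpow hx hx2 hγ0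
      _ ≤ 2 ^ (1:ℝ) := Real.rpow_le_rpow_of_exponent_le (by norm_num) hγ1
      _ = 2 := by simp
  by_cases hm : 2 * n + 1 < m
  · have : ∀ j ∈ Finset.range (n+1), cesKernel α (n-j) *
      (if j ≤ m then (((m:ℝ)+1)/((m:ℝ)-j+1))^(α-ε) else 0) ≤ cesKernel α (n-j) * 2 := by
      intro j hj
      have hj := Finset.mem_range.1 hj
      refine mul_le_mul_of_nonneg_left ?_ (ck_pos hα _).le
      rw [if_pos (by omega)]
      have a1 : (j:ℝ) ≤ n := by exact_mod_cast (by omega : j ≤ n)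
      have a2 : 2 * (n:ℝ) + 1 ≤ m := by exact_mod_cast hm.le
      have a3 : (0:ℝ) ≤ n := by positivity
      apply two
      · apply div_nonneg <;> linarith
      · rw [div_le_iff₀ (by linarith)]; linarith
    refine (Finset.sum_le_sum this).trans ?_
    rw [← Finset.sum_mul]
    have hr := Finset.sum_range_reflect (fun j => cesKernel α j) (n+1)
    simp only [Nat.add_sub_cancel] at hr
    rw [hr, ck_sum hα, mul_comm]
    exact mul_le_mul_of_nonneg_right h2ε (ck_pos (by linarith) _).le
  · obtain ⟨r, hr⟩ : ∃ r, r = min m n := ⟨_, rfl⟩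
    have hmr : (m:ℝ)+1 ≤ 2 * ((r:ℝ)+1) := by exact_mod_cast (by omega : m + 1 ≤ 2 * (r+1))
    have hrn : (r:ℝ) ≤ n := by exact_mod_cast (by omega : r ≤ n)
    have hrm : (r:ℝ) ≤ m := by exact_mod_cast (by omega : r ≤ m)
    have s1 : ∑ j ∈ Finset.range (n+1), cesKernel α (n-j) *
      (if j ≤ m then (((m:ℝ)+1)/((m:ℝ)-j+1))^(α-ε) else 0) =
      ∑ j ∈ Finset.range (r+1), cesKernel α (n-j) *
      (if j ≤ m then (((m:ℝ)+1)/((m:ℝ)-j+1))^(α-ε) else 0) := by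
      symm
      apply Finset.sum_subset
      · intro j; simp only [Finset.mem_range]; omega
      · intro j; simp only [Finset.mem_range]; intro a b
        rw [if_neg (by omega), mul_zero]
    rw [s1]
    have s2 : ∀ j ∈ Finset.range (r+1), cesKernel α (n-j) *
      (if j ≤ m then (((m:ℝ)+1)/((m:ℝ)-j+1))^(α-ε) else 0) ≤
        ((m:ℝ)+1)^(α-ε) * (((r-j:ℕ):ℝ)+1)^(ε-1) := by
      intro j hj
      have hj := Finset.mem_range.1 hj
      rw [if_pos (by omega)]
      have a0 : (j:ℝ) ≤ r := by exact_mod_cast (by omega : j ≤ r)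
      have e1 : ((n-j:ℕ):ℝ) = n - j := by rw [Nat.cast_sub (by omega)]
      have e2 : ((r-j:ℕ):ℝ) = r - j := by rw [Nat.cast_sub (by omega)]
      have b1 : cesKernel α (n-j) ≤ ((r:ℝ)-j+1)^(α-1) := by
        refine (ck_upper hα h1 _).trans ?_
        rw [e1]
        exact Real.rpow_le_rpow_of_nonpos (by linarith) (by linarith) (by linarith)
      have b2 : (((m:ℝ)+1)/((m:ℝ)-j+1))^(α-ε) ≤ ((m:ℝ)+1)^(α-ε) * ((r:ℝ)-j+1)^(-(α-ε)) := by
        rw [Real.div_rpow (by positivity) (by linarith), div_eq_mul_inv,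
          ← Real.rpow_neg (by linarith)]
        refine mul_le_mul_of_nonneg_left ?_ (by positivity)
        exact Real.rpow_le_rpow_of_nonpos (by linarith) (by linarith) (by linarith)
      have pr : 0 < (r:ℝ)-j+1 := by linarith
      calc _ ≤ ((r:ℝ)-j+1)^(α-1) * (((m:ℝ)+1)^(α-ε) * ((r:ℝ)-j+1)^(-(α-ε))) :=
            mul_le_mul b1 b2 (Real.rpow_nonneg (div_nonneg (by positivity) (by linarith)) _)
              (by positivity)
        _ = ((m:ℝ)+1)^(α-ε) * (((r:ℝ)-j+1)^(α-1) * ((r:ℝ)-j+1)^(-(α-ε))) := by ring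
        _ = _ := by
          rw [← Real.rpow_add pr, e2]; congr 2; ring
    refine (Finset.sum_le_sum s2).trans ?_
    rw [← Finset.mul_sum]
    have hrf := Finset.sum_range_reflect (fun j => ((j:ℝ)+1)^(ε-1)) (r+1)
    simp only [Nat.add_sub_cancel] at hrf
    rw [hrf]
    have r0 : (0:ℝ) < (r:ℝ)+1 := by positivity
    calc ((m:ℝ)+1)^(α-ε) * ∑ j ∈ Finset.range (r+1), ((j:ℝ)+1)^(ε-1)
        ≤ (2 * ((r:ℝ)+1))^(α-ε) * (((r:ℝ)+1)^ε/ε) := by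
          gcongr
          exact sum_pow h0 (by linarith) r
      _ = 2^(α-ε) * (((r:ℝ)+1)^(α-ε) * ((r:ℝ)+1)^ε)/ε := by
          rw [Real.mul_rpow (by norm_num) r0.le]; ring
      _ = 2^(α-ε) * ((r:ℝ)+1)^α/ε := by
          rw [← Real.rpow_add r0]; congr 3; ring
      _ ≤ 2 * cesKernel (α+1) n / ε := by
          gcongr
          · exact two 2 (by norm_num) le_rfl
          · exact (Real.rpow_le_rpow r0.le (by linarith) hα.le).trans (ck_lower hα h1 n)
      _ = _ := by ring

section shift
variable {p : ℝ≥0∞} [Fact (1 ≤ p)]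

lemma shift_summable (hp : 0 < p.toReal) (x : lp (fun _ : ℕ => ℂ) p) (f : ℕ → ℂ) (C : ℝ)
    (hC : 0 ≤ C) (n : ℕ) (h : ∀ i, ‖f i‖ ≤ C * ‖x (i+n)‖) :
    Summable (fun i => ‖f i‖ ^ p.toReal) ∧
      ∑' i, ‖f i‖ ^ p.toReal ≤ (C * ‖x‖) ^ p.toReal := by
  have hs := (lp.memℓp x).summable hp
  have hs' := (summable_nat_add_iff n).2 hs
  have hb : ∀ i, ‖f i‖ ^ p.toReal ≤ C ^ p.toReal * ‖x (i+n)‖ ^ p.toReal := fun i => by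
    rw [← Real.mul_rpow hC (norm_nonneg _)]
    exact Real.rpow_le_rpow (norm_nonneg _) (h i) hp.le
  have hsf : Summable (fun i => ‖f i‖ ^ p.toReal) :=
    Summable.of_nonneg_of_le (fun i => by positivity) hb (hs'.mul_left _)
  refine ⟨hsf, ?_⟩
  rw [Real.mul_rpow hC (norm_nonneg _), lp.norm_rpow_eq_tsum hp]
  calc _ ≤ ∑' i, C ^ p.toReal * ‖x (i+n)‖ ^ p.toReal := hsf.tsum_le_tsum hb (hs'.mul_left _)
    _ = C ^ p.toReal * ∑' i, ‖x (i+n)‖ ^ p.toReal := tsum_mul_left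
    _ ≤ _ := by
      refine mul_le_mul_of_nonneg_left ?_ (by positivity)
      rw [← hs.sum_add_tsum_nat_add n]
      exact le_add_of_nonneg_left (Finset.sum_nonneg fun i _ => by positivity)

/-- weights -/
noncomputable def wgt (s : ℝ) (n i : ℕ) : ℝ := (((i:ℝ)+n+1)/((i:ℝ)+1))^s

lemma wgt_nonneg (s : ℝ) (n i : ℕ) : 0 ≤ wgt s n i := by unfold wgt; positivity

lemma wgt_le {s : ℝ} (hs : 0 ≤ s) (n i : ℕ) : wgt s n i ≤ ((n:ℝ)+1)^s := by
  unfold wgt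
  refine Real.rpow_le_rpow (by positivity) ?_ hs
  rw [div_le_iff₀ (by positivity)]
  have : (0:ℝ) ≤ n * i := by positivity
  linarith

lemma wgt_bound {s : ℝ} (hs : 0 ≤ s) (n i : ℕ) (z : ℂ) :
    ‖(wgt s n i : ℂ) * z‖ ≤ ((n:ℝ)+1)^s * ‖z‖ := by
  rw [norm_mul, Complex.norm_real, Real.norm_of_nonneg (wgt_nonneg _ _ _)]
  exact mul_le_mul_of_nonneg_right (wgt_le hs n i) (norm_nonneg _)

/-- The weighted backward shift. -/
noncomputable def wshift (hp : 0 < p.toReal) {s : ℝ} (hs : 0 ≤ s) :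
    lp (fun _ : ℕ => ℂ) p →L[ℂ] lp (fun _ : ℕ => ℂ) p :=
  LinearMap.mkContinuous
    { toFun := fun x => ⟨fun i => (wgt s 1 i : ℂ) * x (i+1),
        memℓp_gen (shift_summable hp x _ _ (by positivity) 1 (fun i => wgt_bound hs 1 i _)).1⟩
      map_add' := fun x y => by
        ext i
        exact mul_add _ _ _
      map_smul' := fun c x => by
        ext i
        simp [mul_left_comm] } ((((1:ℕ):ℝ)+1)^s) (fun x =>
      lp.norm_le_of_tsum_le hp (by positivity)
        (shift_summable hp x _ _ (by positivity) 1 (fun i => wgt_bound hs 1 i _)).2)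

lemma wshift_apply (hp : 0 < p.toReal) {s : ℝ} (hs : 0 ≤ s) (x : lp (fun _ : ℕ => ℂ) p) (i : ℕ) :
    wshift hp hs x i = (wgt s 1 i : ℂ) * x (i+1) := rfl

lemma wshift_pow (hp : 0 < p.toReal) {s : ℝ} (hs : 0 ≤ s) (n : ℕ) (x : lp (fun _ : ℕ => ℂ) p)
    (i : ℕ) : ((wshift hp hs ^ n) x) i = (wgt s n i : ℂ) * x (i+n) := by
  induction n generalizing i with
  | zero => 
    have : ((i:ℝ) + 1) ≠ 0 := by positivity
    simp [wgt, this]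
  | succ n ih =>
    rw [pow_succ']
    change wshift hp hs ((wshift hp hs ^ n) x) i = _
    rw [wshift_apply, ih, ← mul_assoc, ← Complex.ofReal_mul]
    have : wgt s 1 i * wgt s n (i+1) = wgt s (n+1) i := by
      unfold wgt
      rw [← Real.mul_rpow (by positivity) (by positivity)]
      congr 1
      push_cast
      field_simp
      ring
    rw [this, show i + 1 + n = i + (n+1) by ring]

lemma wshift_single (hp : 0 < p.toReal) {s : ℝ} (hs : 0 ≤ s) (n i : ℕ) (c : ℂ) :
    (wshift hp hs ^ n) (lp.single p (i+n) c) = lp.single p i ((wgt s n i : ℂ) * c) := by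
  ext k
  rw [wshift_pow, lp.single_apply, lp.single_apply]
  by_cases h : k = i
  · subst h; simp
  · rw [Pi.single_eq_of_ne h, Pi.single_eq_of_ne (by omega), mul_zero]

lemma wshift_norm (hp : 0 < p.toReal) {s : ℝ} (hs : 0 ≤ s) (n : ℕ) :
    ‖wshift (p := p) hp hs ^ n‖ = ((n:ℝ)+1)^s := by
  have hp' : 0 < p := zero_lt_one.trans_le Fact.out
  apply le_antisymm
  · refine ContinuousLinearMap.opNorm_le_bound _ (by positivity) fun x => ?_
    refine lp.norm_le_of_tsum_le hp (by positivity) (shift_summable hp x _ _ (by positivity) n ?_).2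
    intro i
    rw [wshift_pow]
    exact wgt_bound hs n i _
  · have h := (wshift (p := p) hp hs ^ n).le_opNorm (lp.single p (0+n) 1)
    rw [wshift_single, lp.norm_single hp', lp.norm_single hp', norm_mul, Complex.norm_real,
      Real.norm_of_nonneg (wgt_nonneg _ _ _)] at h
    simpa [wgt] using h

lemma wshift_mixing (hp : 0 < p.toReal) (hpt : p ≠ ⊤) {s : ℝ} (hs : 0 < s) :
    TopologicallyMixing (wshift (p := p) hp hs.le) := by
  have hp' : 0 < p := zero_lt_one.trans_le Fact.out
  have dense : ∀ U : Set (lp (fun _ : ℕ => ℂ) p), IsOpen U → U.Nonempty →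
      ∃ (N : ℕ) (a : ℕ → ℂ), ∑ i ∈ Finset.range N, lp.single p i (a i) ∈ U := by
    rintro U hU ⟨x, hx⟩
    have h := (lp.hasSum_single hpt x).tendsto_sum_nat
    obtain ⟨N, hN⟩ := (h.eventually (hU.mem_nhds hx)).exists
    exact ⟨N, fun i => x i, hN⟩
  intro U V hU hV hUn hVn
  obtain ⟨N, a, ha⟩ := dense U hU hUn
  obtain ⟨M, b, hb⟩ := dense V hV hVn
  set x := ∑ i ∈ Finset.range N, lp.single (E := fun _ : ℕ => ℂ) p i (a i) with hx
  let S : ℕ → lp (fun _ : ℕ => ℂ) p := fun n =>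
    ∑ i ∈ Finset.range M, lp.single p (i+n) (((wgt s n i)⁻¹ : ℝ) * b i : ℂ)
  have hS : Tendsto S atTop (nhds 0) := by
    rw [← Finset.sum_const_zero (s := Finset.range M)]
    refine tendsto_finsetSum _ fun i _ => ?_
    rw [tendsto_zero_iff_norm_tendsto_zero]
    simp_rw [lp.norm_single hp', norm_mul, Complex.norm_real]
    rw [← zero_mul ‖b i‖]
    refine Tendsto.mul_const _ ?_
    rw [← norm_zero (E := ℝ)]
    refine Tendsto.norm (Tendsto.inv_tendsto_atTop ?_)
    unfold wgt
    refine (tendsto_rpow_atTop hs).comp ?_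
    refine Tendsto.atTop_div_const (by positivity) ?_
    refine tendsto_atTop_add_const_right _ _ ?_
    exact tendsto_atTop_add_const_left _ _ tendsto_natCast_atTop_atTop
  have hxS : Tendsto (fun n => x + S n) atTop (nhds x) := by
    simpa using hS.const_add x
  obtain ⟨n₁, hn₁⟩ := eventually_atTop.1 (hxS.eventually (hU.mem_nhds ha))
  refine ⟨max n₁ N, fun n hn => ⟨_, ⟨x + S n, hn₁ n (le_of_max_le_left hn), rfl⟩, ?_⟩⟩
  have h0 : (wshift hp hs.le ^ n) x = 0 := by
    ext k
    have hN : N ≤ n := le_of_max_le_right hn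
    rw [wshift_pow, hx, lp.coeFn_sum, Finset.sum_apply, Finset.sum_eq_zero]
    · simp
    · intro i hi
      have := Finset.mem_range.1 hi
      exact lp.single_apply_ne _ _ _ (by omega)
  have h1 : (wshift hp hs.le ^ n) (S n) = ∑ i ∈ Finset.range M, lp.single p i (b i) := by
    simp only [S, map_sum]
    refine Finset.sum_congr rfl fun i _ => ?_
    rw [wshift_single]
    congr 1
    have : wgt s n i ≠ 0 := by unfold wgt; positivity
    rw [← mul_assoc, ← Complex.ofReal_mul, mul_inv_cancel₀ this]
    simp
  rw [map_add, h0, h1, zero_add]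
  exact hb

lemma wshift_ces (hp : 0 < p.toReal) (hp1 : 1 ≤ p.toReal) {α ε : ℝ} (h0 : 0 < ε) (h : ε < α)
    (h1 : α ≤ 1) (hs : 0 ≤ (α-ε)/p.toReal) :
    AbsCesaroBounded α (wshift (p := p) hp hs) := by
  have hα : 0 < α := h0.trans h
  refine ⟨(2/ε)^(1/p.toReal), by positivity, fun n x => ?_⟩
  set q := p.toReal with hq
  set K := cesKernel (α+1) n with hK
  have hK0 : 0 < K := ck_pos (by linarith) n
  set T := wshift (p := p) hp hs with hT
  have hxs := (lp.memℓp x).summable hp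
  let F : ℕ → ℕ → ℝ := fun j m =>
    (if j ≤ m then (((m:ℝ)+1)/((m:ℝ)-j+1))^(α-ε) else 0) * ‖x m‖ ^ q
  have hF0 : ∀ j m, 0 ≤ F j m := by
    intro j m
    refine mul_nonneg ?_ (by positivity)
    split_ifs with hj
    · have : (j:ℝ) ≤ m := by exact_mod_cast hj
      exact Real.rpow_nonneg (div_nonneg (by positivity) (by linarith)) _
    · rfl
  have hFshift : ∀ j i, ‖((T ^ j) x) i‖ ^ q = F j (i+j) := by
    intro j i
    simp only [F]
    rw [hT, wshift_pow, norm_mul, Complex.norm_real, Real.norm_of_nonneg (wgt_nonneg _ _ _),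
      Real.mul_rpow (wgt_nonneg _ _ _) (norm_nonneg _), if_pos (by omega)]
    congr 1
    unfold wgt
    rw [← Real.rpow_mul (by positivity), div_mul_cancel₀ _ hp.ne']
    push_cast
    congr 2
    ring
  have hFs : ∀ j, Summable (F j) := by
    intro j
    rw [← summable_nat_add_iff j]
    simp_rw [← hFshift]
    exact (lp.memℓp ((T^j) x)).summable hp
  have hFn : ∀ j, ‖(T^j) x‖ ^ q = ∑' m, F j m := by
    intro j
    rw [lp.norm_rpow_eq_tsum hp, ← (hFs j).sum_add_tsum_nat_add j, Finset.sum_eq_zero, zero_add]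
    · exact tsum_congr (hFshift j)
    · intro i hi
      have := Finset.mem_range.1 hi
      simp only [F]
      rw [if_neg (by omega), zero_mul]
  have main : ∑ j ∈ Finset.range (n+1), cesKernel α (n-j) * ‖(T^j) x‖ ^ q
      ≤ (2/ε) * K * ‖x‖ ^ q := by
    simp_rw [hFn, ← tsum_mul_left]
    rw [← Summable.tsum_finsetSum (fun j _ => (hFs j).mul_left _), lp.norm_rpow_eq_tsum hp,
      ← tsum_mul_left]
    refine Summable.tsum_le_tsum (fun m => ?_)
      (summable_sum fun j _ => (hFs j).mul_left _) (hxs.mul_left _)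
    simp only [F, ← mul_assoc]
    rw [← Finset.sum_mul]
    exact mul_le_mul_of_nonneg_right (key h0 h h1 m n) (by positivity)
  have hr := Finset.sum_range_reflect (fun j => cesKernel α j) (n+1)
  simp only [Nat.add_sub_cancel] at hr
  rw [ck_sum hα] at hr
  have jen := Real.rpow_arith_mean_le_arith_mean_rpow (Finset.range (n+1))
    (fun j => K⁻¹ * cesKernel α (n-j)) (fun j => ‖(T^j) x‖)
    (fun j _ => mul_nonneg (by positivity) (ck_pos hα _).le)
    (by rw [← Finset.mul_sum, hr]; exact inv_mul_cancel₀ hK0.ne')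
    (fun j _ => norm_nonneg _) hp1
  simp only [mul_assoc, ← Finset.mul_sum] at jen
  have hL : 0 ≤ K⁻¹ * ∑ j ∈ Finset.range (n+1), cesKernel α (n-j) * ‖(T^j) x‖ :=
    mul_nonneg (by positivity) (Finset.sum_nonneg fun j _ =>
      mul_nonneg (ck_pos hα _).le (norm_nonneg _))
  rw [← Real.rpow_le_rpow_iff hL (by positivity) hp]
  refine jen.trans ?_
  rw [Real.mul_rpow (by positivity) (norm_nonneg _), ← Real.rpow_mul (by positivity),
    one_div_mul_cancel hp.ne', Real.rpow_one]
  calc _ ≤ K⁻¹ * ((2/ε) * K * ‖x‖ ^ q) := by gcongr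
    _ = _ := by field_simp

end shift

/-- Let `1 ≤ p < ∞` and `0 < ε < α ≤ 1`. There exists a bounded linear operator `T` on
`ℓ^p(ℕ)` which is absolutely `(C,α)`-Cesàro bounded, topologically mixing, and satisfies
`‖T^n‖ = (n+1)^{(α-ε)/p}` for all `n ∈ ℕ₀`. -/
theorem stmt2 (p : ℝ≥0∞) [Fact (1 ≤ p)] (hp : p ≠ ⊤) (α ε : ℝ)
    (hε0 : 0 < ε) (hεα : ε < α) (hα1 : α ≤ 1) :
    ∃ T : lp (fun _ : ℕ => ℂ) p →L[ℂ] lp (fun _ : ℕ => ℂ) p,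
      AbsCesaroBounded α T ∧ TopologicallyMixing T ∧
      ∀ n : ℕ, ‖T ^ n‖ = ((n : ℝ) + 1) ^ ((α - ε) / p.toReal) := by
  have hp1 : 1 ≤ p.toReal := by
    have h := (ENNReal.toReal_le_toReal ENNReal.one_ne_top hp).2 (Fact.out : 1 ≤ p)
    simpa using h
  have hp0 : 0 < p.toReal := by linarith
  have hs : 0 < (α - ε) / p.toReal := div_pos (by linarith) hp0
  exact ⟨wshift hp0 hs.le, wshift_ces hp0 hp1 hε0 hεα hα1 hs.le, wshift_mixing hp0 hp hs,
    wshift_norm hp0 hs.le⟩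
end

section
/- Let H be a complex Hilbert space, 0 < α ≤ 1, and let T be an absolutely (C,α)-Cesàro bounded operator on H. Then ‖T^n‖ / n^{min(α, 1/2)} → 0 as n → ∞. -/
open Filter
open scoped ENNReal

/-- Rademacher average of a function over the signed sums of `v 0, …, v (n-1)`. -/
noncomputable def radAvg {H : Type*} [AddCommGroup H] (v : ℕ → H) : ℕ → ((H → ℝ) →ₗ[ℝ] ℝ)
  | 0 => LinearMap.proj 0
  | n + 1 => (1 / 2 : ℝ) • (radAvg v n ∘ₗ LinearMap.funLeft ℝ ℝ (fun y => y + v n)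
      + radAvg v n ∘ₗ LinearMap.funLeft ℝ ℝ (fun y => y - v n))

section Rad
variable {H : Type*} [NormedAddCommGroup H] [InnerProductSpace ℂ H]

lemma radAvg_zero (v : ℕ → H) (φ : H → ℝ) : radAvg v 0 φ = φ 0 := rfl

lemma radAvg_succ' (v : ℕ → H) (n : ℕ) (φ : H → ℝ) :
    radAvg v (n + 1) φ = (1 / 2 : ℝ) * (radAvg v n (fun y => φ (y + v n))
      + radAvg v n (fun y => φ (y - v n))) := rfl

lemma radAvg_succ (v : ℕ → H) (n : ℕ) (φ : H → ℝ) :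
    radAvg v (n + 1) φ = radAvg v n (fun y => (1 / 2 : ℝ) * (φ (y + v n) + φ (y - v n))) := by
  rw [radAvg_succ', ← map_add, ← smul_eq_mul, ← map_smul]
  rfl

lemma radAvg_mono (v : ℕ → H) (n : ℕ) : ∀ (φ ψ : H → ℝ), (∀ y, φ y ≤ ψ y) →
    radAvg v n φ ≤ radAvg v n ψ := by
  induction n with
  | zero => intro φ ψ h; exact h 0
  | succ n ih =>
    intro φ ψ h
    rw [radAvg_succ, radAvg_succ]
    apply ih
    intro y
    have h1 := h (y + v n)
    have h2 := h (y - v n)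
    linarith

lemma radAvg_const (v : ℕ → H) (n : ℕ) (c : ℝ) : radAvg v n (fun _ => c) = c := by
  induction n with
  | zero => rfl
  | succ n ih =>
    rw [radAvg_succ', ih]; ring

lemma radAvg_add (v : ℕ → H) (n : ℕ) (φ ψ : H → ℝ) :
    radAvg v n (fun y => φ y + ψ y) = radAvg v n φ + radAvg v n ψ := map_add _ φ ψ

lemma radAvg_mul (v : ℕ → H) (n : ℕ) (c : ℝ) (φ : H → ℝ) :
    radAvg v n (fun y => c * φ y) = c * radAvg v n φ := map_smul _ c φ

lemma radAvg_sum {ι : Type*} (s : Finset ι) (v : ℕ → H) (n : ℕ) (φ : ι → H → ℝ) :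
    radAvg v n (fun y => ∑ i ∈ s, φ i y) = ∑ i ∈ s, radAvg v n (φ i) := by
  rw [← map_sum]
  congr 1
  ext y
  simp

lemma radAvg_comp (S : H →L[ℂ] H) (v : ℕ → H) (n : ℕ) : ∀ (φ : H → ℝ),
    radAvg v n (fun y => φ (S y)) = radAvg (fun j => S (v j)) n φ := by
  induction n with
  | zero => intro φ; simp [radAvg_zero]
  | succ n ih =>
    intro φ
    rw [radAvg_succ', radAvg_succ', ← ih, ← ih]
    simp

lemma radAvg_sq (v : ℕ → H) (n : ℕ) :
    radAvg v n (fun y => ‖y‖ ^ 2) = ∑ j ∈ Finset.range n, ‖v j‖ ^ 2 := by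
  induction n with
  | zero => simp [radAvg_zero]
  | succ n ih =>
    rw [radAvg_succ, Finset.sum_range_succ, ← ih]
    have : (fun y : H => (1 / 2 : ℝ) * (‖y + v n‖ ^ 2 + ‖y - v n‖ ^ 2))
        = fun y => ‖y‖ ^ 2 + ‖v n‖ ^ 2 := by
      ext y
      rw [@norm_add_sq ℂ, @norm_sub_sq ℂ]
      ring
    rw [this, radAvg_add, radAvg_const]

lemma radAvg_four (v : ℕ → H) (n : ℕ) :
    radAvg v n (fun y => ‖y‖ ^ 4) ≤ 3 * (∑ j ∈ Finset.range n, ‖v j‖ ^ 2) ^ 2 := by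
  induction n with
  | zero => simp [radAvg_zero]
  | succ n ih =>
    rw [radAvg_succ, Finset.sum_range_succ]
    have h1 : radAvg v n (fun y : H => (1 / 2 : ℝ) * (‖y + v n‖ ^ 4 + ‖y - v n‖ ^ 4))
        ≤ radAvg v n (fun y => ‖y‖ ^ 4 + ((6 * ‖v n‖ ^ 2) * ‖y‖ ^ 2 + ‖v n‖ ^ 4)) := by
      apply radAvg_mono
      intro y
      have e1 : ‖y + v n‖ ^ 4 = (‖y + v n‖ ^ 2) ^ 2 := by ring
      have e2 : ‖y - v n‖ ^ 4 = (‖y - v n‖ ^ 2) ^ 2 := by ring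
      rw [e1, e2, @norm_add_sq ℂ, @norm_sub_sq ℂ]
      have hr : |RCLike.re (inner ℂ y (v n))| ≤ ‖y‖ * ‖v n‖ :=
        (RCLike.abs_re_le_norm _).trans (norm_inner_le_norm _ _)
      have hr2 := sq_le_sq' (abs_le.mp hr).1 (abs_le.mp hr).2
      nlinarith [hr2]
    rw [radAvg_add v n (fun y => ‖y‖ ^ 4), radAvg_add, radAvg_mul v n (6 * ‖v n‖ ^ 2), radAvg_const, radAvg_sq] at h1
    have : ‖v n‖ ^ 4 = (‖v n‖ ^ 2) ^ 2 := by ring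
    nlinarith [sq_nonneg (‖v n‖ ^ 2)]

lemma radAvg_norm_lower (v : ℕ → H) (n : ℕ) :
    (5 / 9 : ℝ) * √(∑ j ∈ Finset.range n, ‖v j‖ ^ 2) ≤ radAvg v n (fun y => ‖y‖) := by
  set s := ∑ j ∈ Finset.range n, ‖v j‖ ^ 2 with hs
  have hs0 : 0 ≤ s := Finset.sum_nonneg (fun _ _ => by positivity)
  rcases hs0.eq_or_lt with h | h
  · rw [← h]
    simp only [Real.sqrt_zero, mul_zero]
    have := radAvg_mono v n (fun _ => 0) (fun y => ‖y‖) (fun y => norm_nonneg y)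
    rwa [radAvg_const] at this
  · obtain ⟨σ, hσ⟩ : ∃ σ, σ = √s := ⟨_, rfl⟩
    have hσ0 : 0 < σ := by rw [hσ]; exact Real.sqrt_pos.mpr h
    have hσ2 : s = σ ^ 2 := by rw [hσ, Real.sq_sqrt hs0]
    have h1 : radAvg v n (fun y => (1 / σ) * ‖y‖ ^ 2 + (-(4 / (27 * σ ^ 3))) * ‖y‖ ^ 4)
        ≤ radAvg v n (fun y => ‖y‖) := by
      apply radAvg_mono
      intro y
      have hy := norm_nonneg y
      obtain ⟨u, hu⟩ : ∃ u, u = ‖y‖ / σ := ⟨_, rfl⟩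
      have hyu : ‖y‖ = u * σ := by rw [hu]; field_simp
      have hu0 : 0 ≤ u := by rw [hu]; positivity
      rw [hyu]
      have e : (1 / σ) * (u * σ) ^ 2 + (-(4 / (27 * σ ^ 3))) * (u * σ) ^ 4
          = σ * (u ^ 2 - 4 / 27 * u ^ 4) := by field_simp; ring
      rw [e]
      have : u ^ 2 - 4 / 27 * u ^ 4 ≤ u := by
        have : 0 ≤ u * ((u - 3 / 2) ^ 2 * (u + 3)) := by positivity
        nlinarith
      nlinarith
    rw [radAvg_add, radAvg_mul, radAvg_mul, radAvg_sq, ← hs] at h1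
    have h4 := radAvg_four v n
    rw [← hs] at h4
    have h5 : 4 / (27 * σ ^ 3) * radAvg v n (fun y => ‖y‖ ^ 4) ≤ 4 / (27 * σ ^ 3) * (3 * s ^ 2) :=
      mul_le_mul_of_nonneg_left h4 (by positivity)
    have e1 : 4 / (27 * σ ^ 3) * (3 * s ^ 2) = 4 / 9 * σ := by
      rw [hσ2]; field_simp; norm_num
    have e2 : 1 / σ * s = σ := by rw [hσ2]; field_simp
    rw [← hσ]
    linarith

lemma radAvg_norm_upper (v : ℕ → H) (n : ℕ) (σ : ℝ) (hσ : 0 < σ)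
    (h : ∑ j ∈ Finset.range n, ‖v j‖ ^ 2 ≤ σ ^ 2) : radAvg v n (fun y => ‖y‖) ≤ σ := by
  have h1 : radAvg v n (fun y => ‖y‖)
      ≤ radAvg v n (fun y => (1 / (2 * σ)) * ‖y‖ ^ 2 + σ / 2) := by
    apply radAvg_mono
    intro y
    have : (1 / (2 * σ)) * ‖y‖ ^ 2 + σ / 2 - ‖y‖ = (‖y‖ - σ) ^ 2 / (2 * σ) := by
      field_simp; ring
    have : 0 ≤ (‖y‖ - σ) ^ 2 / (2 * σ) := by positivity
    linarith
  rw [radAvg_add, radAvg_mul, radAvg_const, radAvg_sq] at h1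
  have h5 : 1 / (2 * σ) * ∑ j ∈ Finset.range n, ‖v j‖ ^ 2 ≤ 1 / (2 * σ) * σ ^ 2 :=
    mul_le_mul_of_nonneg_left h (by positivity)
  have e : 1 / (2 * σ) * σ ^ 2 = σ / 2 := by field_simp
  linarith

lemma pair_bound (T : H →L[ℂ] H) (C : ℝ)
    (hC : ∀ (n : ℕ) (x : H), ∑ j ∈ Finset.range n, ‖(T ^ j) x‖ ≤ C * n * ‖x‖) (hC0 : 0 < C)
    (v : ℕ → H) (m n : ℕ) (hm : 0 < m) (hv : ∀ j, ‖v j‖ ≤ 1) (u : ℕ → ℕ → ℝ)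
    (hu : ∀ i, ∑ j ∈ Finset.range m, u i j ^ 2 ≤ 1) :
    ∑ i ∈ Finset.range n, ∑ j ∈ Finset.range m, u i j * ‖(T ^ i) (v j)‖
      ≤ 2 * C * n * √m := by
  have hm' : (0 : ℝ) < m := by exact_mod_cast hm
  have h1 := radAvg_mono v m (fun y => ∑ i ∈ Finset.range n, ‖(T ^ i) y‖)
    (fun y => (C * n) * ‖y‖) (fun y => hC n y)
  rw [radAvg_mul, radAvg_sum] at h1
  have h2 := radAvg_norm_upper v m (√m) (Real.sqrt_pos.mpr hm') (by
    rw [Real.sq_sqrt hm'.le]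
    calc ∑ j ∈ Finset.range m, ‖v j‖ ^ 2 ≤ ∑ j ∈ Finset.range m, (1 : ℝ) :=
          Finset.sum_le_sum (fun j _ => pow_le_one₀ (norm_nonneg _) (hv j))
      _ = m := by simp)
  have h3 : ∀ i ∈ Finset.range n, (5 / 9 : ℝ) * ∑ j ∈ Finset.range m, u i j * ‖(T ^ i) (v j)‖
      ≤ radAvg v m (fun y => ‖(T ^ i) y‖) := by
    intro i _
    rw [radAvg_comp (T ^ i) v m (fun y => ‖y‖)]
    refine le_trans ?_ (radAvg_norm_lower _ _)
    apply mul_le_mul_of_nonneg_left _ (by norm_num)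
    apply Real.le_sqrt_of_sq_le
    refine (Finset.sum_mul_sq_le_sq_mul_sq _ _ _).trans ?_
    have h0 : 0 ≤ ∑ j ∈ Finset.range m, ‖(T ^ i) (v j)‖ ^ 2 :=
      Finset.sum_nonneg (fun _ _ => by positivity)
    nlinarith [hu i]
  have h4 := Finset.sum_le_sum h3
  rw [← Finset.mul_sum] at h4
  have h5 : C * n * radAvg v m (fun y => ‖y‖) ≤ C * n * √m :=
    mul_le_mul_of_nonneg_left h2 (by positivity)
  have : 0 ≤ C * n * √m := by positivity
  linarith

lemma core_bound (T : H →L[ℂ] H) (C : ℝ)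
    (hC : ∀ (n : ℕ) (x : H), ∑ j ∈ Finset.range n, ‖(T ^ j) x‖ ≤ C * n * ‖x‖) (hC0 : 0 < C)
    (N m p : ℕ) (hm : 0 < m) (hp : 0 < p) (hpm : p + m ≤ N + 1) (w d : ℕ → ℝ)
    (hw : ∀ l, 0 ≤ w l) (hd : ∀ l, 0 ≤ d l) (hw1 : ∑ l ∈ Finset.range p, w l ^ 2 ≤ 1)
    (hdT : ∀ l z, d l * ‖(T ^ l) z‖ ≤ ‖z‖) (x : H) :
    ‖(T ^ N) x‖ * (∑ l ∈ Finset.range p, w l * d l) * m ≤ 2 * C ^ 2 * (N + 1) * √m * ‖x‖ := by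
  have hm' : (0 : ℝ) < m := by exact_mod_cast hm
  by_cases hN : (T ^ N) x = 0
  · rw [hN]; simp only [norm_zero, zero_mul]; positivity
  have hadd : ∀ i j, (T ^ (i + j)) x = (T ^ i) ((T ^ j) x) := by
    intro i j; rw [pow_add]; rfl
  have hpos : ∀ j, j ≤ N → 0 < ‖(T ^ j) x‖ := by
    intro j hj
    rw [norm_pos_iff]
    intro h0
    apply hN
    have := hadd (N - j) j
    rw [Nat.sub_add_cancel hj] at this
    rw [this, h0, map_zero]
  set a : ℕ → ℝ := fun j => ‖(T ^ j) x‖ with ha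
  set S := ∑ l ∈ Finset.range p, w l * d l with hS
  have hS0 : 0 ≤ S := Finset.sum_nonneg (fun l _ => mul_nonneg (hw l) (hd l))
  let u : ℕ → ℕ → ℝ := fun i j => if i + j ≤ N ∧ N - i - j < p then w (N - i - j) else 0
  have hu0 : ∀ i j, 0 ≤ u i j := by
    intro i j; dsimp [u]; split_ifs; exacts [hw _, le_rfl]
  have hu : ∀ i, ∑ j ∈ Finset.range m, u i j ^ 2 ≤ 1 := by
    intro i
    refine le_trans ?_ hw1
    have e : ∀ j, u i j ^ 2 = if i + j ≤ N ∧ N - i - j < p then w (N - i - j) ^ 2 else 0 := by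
      intro j; dsimp [u]; split_ifs <;> simp
    rw [Finset.sum_congr rfl (fun j _ => e j), ← Finset.sum_filter]
    rw [← Finset.sum_image (f := fun l => w l ^ 2) (g := fun j => N - i - j)]
    · apply Finset.sum_le_sum_of_subset_of_nonneg
      · intro l hl
        simp only [Finset.mem_image, Finset.mem_filter, Finset.mem_range] at hl ⊢
        omega
      · intros; positivity
    · intro j hj k hk hjk
      simp only [Finset.coe_filter, Set.mem_setOf_eq, Finset.mem_range] at hj hk hjk
      omega
  let v : ℕ → H := fun j => ((‖(T ^ j) x‖⁻¹ : ℝ) : ℂ) • (T ^ j) x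
  have hvn : ∀ i j, ‖(T ^ i) (v j)‖ = (a j)⁻¹ * a (i + j) := by
    intro i j
    simp only [v, ha, map_smul, norm_smul, hadd]
    simp
  have hv : ∀ j, ‖v j‖ ≤ 1 := by
    intro j
    have := hvn 0 j
    simp only [pow_zero, one_apply_eq_self, zero_add] at this
    rw [this]
    exact inv_mul_le_one
  have hP := pair_bound T C hC hC0 v m (N + 1) hm hv u hu
  rw [Finset.sum_comm] at hP
  have hlow : ∀ j ∈ Finset.range m, a N * S * (a j)⁻¹
      ≤ ∑ i ∈ Finset.range (N + 1), u i j * ‖(T ^ i) (v j)‖ := by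
    intro j hj
    rw [Finset.mem_range] at hj
    have hj0 : 0 < a j := hpos j (by omega)
    have hstep : ∑ l ∈ Finset.range p, u (N - j - l) j * ‖(T ^ (N - j - l)) (v j)‖
        ≤ ∑ i ∈ Finset.range (N + 1), u i j * ‖(T ^ i) (v j)‖ := by
      rw [← Finset.sum_image (f := fun i => u i j * ‖(T ^ i) (v j)‖) (g := fun l => N - j - l)]
      · apply Finset.sum_le_sum_of_subset_of_nonneg
        · intro l hl
          simp only [Finset.mem_image, Finset.mem_range] at hl ⊢
          omega
        · intros; exact mul_nonneg (hu0 _ _) (norm_nonneg _)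
      · intro l hl k hk hlk
        simp only [Finset.coe_range, Set.mem_Iio] at hl hk hlk
        omega
    refine le_trans ?_ hstep
    rw [hS, Finset.mul_sum, Finset.sum_mul]
    apply Finset.sum_le_sum
    intro l hl
    rw [Finset.mem_range] at hl
    have e1 : u (N - j - l) j = w l := by
      have h1 : N - j - l + j ≤ N ∧ N - (N - j - l) - j < p := by omega
      have h2 : N - (N - j - l) - j = l := by omega
      simp only [u, if_pos h1, h2]
    rw [e1, hvn]
    have e2 : N - j - l + j = N - l := by omega
    rw [e2]
    have h3 : d l * a N ≤ a (N - l) := by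
      have h4 := hdT l ((T ^ (N - l)) x)
      rw [← hadd] at h4
      rwa [show l + (N - l) = N by omega] at h4
    calc a N * (w l * d l) * (a j)⁻¹ = w l * ((a j)⁻¹ * (d l * a N)) := by ring
      _ ≤ w l * ((a j)⁻¹ * a (N - l)) := by
        apply mul_le_mul_of_nonneg_left _ (hw l)
        exact mul_le_mul_of_nonneg_left h3 (by positivity)
  have hsum := (Finset.sum_le_sum hlow).trans hP
  rw [← Finset.mul_sum] at hsum
  -- Cauchy-Schwarz
  have hcs : (m : ℝ) ^ 2 ≤ (∑ j ∈ Finset.range m, (a j)⁻¹) * (∑ j ∈ Finset.range m, a j) := by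
    have := Finset.sum_sq_le_sum_mul_sum_of_sq_eq_mul (Finset.range m) (r := fun _ => (1 : ℝ))
      (f := fun j => (a j)⁻¹) (g := a) (fun j _ => by positivity) (fun j _ => norm_nonneg _)
      (fun j hj => by
        have : 0 < a j := hpos j (by rw [Finset.mem_range] at hj; omega)
        field_simp)
    simpa using this
  have hI0 : 0 ≤ ∑ j ∈ Finset.range m, (a j)⁻¹ :=
    Finset.sum_nonneg (fun j _ => inv_nonneg.mpr (norm_nonneg _))
  have hcs2 : (m : ℝ) ^ 2 ≤ (∑ j ∈ Finset.range m, (a j)⁻¹) * (C * m * ‖x‖) :=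
    hcs.trans (mul_le_mul_of_nonneg_left (hC m x) hI0)
  have haN : 0 ≤ a N * S := mul_nonneg (norm_nonneg _) hS0
  have h6 : (a N * S) * (m : ℝ) ^ 2 ≤ (2 * C * ((N + 1 : ℕ) : ℝ) * √m) * (C * m * ‖x‖) := by
    calc (a N * S) * (m : ℝ) ^ 2
        ≤ (a N * S) * ((∑ j ∈ Finset.range m, (a j)⁻¹) * (C * m * ‖x‖)) :=
          mul_le_mul_of_nonneg_left hcs2 haN
      _ = (a N * S * (∑ j ∈ Finset.range m, (a j)⁻¹)) * (C * m * ‖x‖) := by ring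
      _ ≤ _ := mul_le_mul_of_nonneg_right hsum (by positivity)
  push_cast at h6
  have h7 : (m : ℝ) * (a N * S * m) ≤ m * (2 * C ^ 2 * (N + 1) * √m * ‖x‖) := by
    nlinarith
  exact le_of_mul_le_mul_left h7 hm'

/-- Harmonic sums. -/
noncomputable def harm (n : ℕ) : ℝ := ∑ l ∈ Finset.range n, 1 / ((l : ℝ) + 1)

lemma harm_tendsto : Tendsto harm atTop atTop :=
  Real.tendsto_sum_range_one_div_nat_succ_atTop

lemma harm_pos (n : ℕ) (hn : 0 < n) : 0 < harm n := by
  apply Finset.sum_pos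
  · intros; positivity
  · exact Finset.nonempty_range_iff.mpr hn.ne'

lemma sqrt_bound (T : H →L[ℂ] H) (C : ℝ)
    (hC : ∀ (n : ℕ) (x : H), ∑ j ∈ Finset.range n, ‖(T ^ j) x‖ ≤ C * n * ‖x‖) (hC0 : 0 < C)
    (N : ℕ) (x : H) : ‖(T ^ N) x‖ ≤ (4 * C ^ 2 + 1) * √(N + 1) * ‖x‖ := by
  rcases Nat.eq_zero_or_pos N with h | h
  · subst h
    simp only [pow_zero, one_apply_eq_self, Nat.cast_zero, zero_add, Real.sqrt_one]
    have := norm_nonneg x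
    nlinarith [sq_nonneg C, mul_nonneg (sq_nonneg C) this]
  · have h1 := core_bound T C hC hC0 N N 1 h one_pos (by omega) (fun _ => 1)
      (fun l => if l = 0 then 1 else 0) (fun _ => zero_le_one)
      (fun l => by split_ifs <;> norm_num) (by simp)
      (fun l z => by
        split_ifs with hl
        · subst hl; simp
        · simp) x
    simp only [Finset.range_one, Finset.sum_singleton, if_true, mul_one] at h1
    have hN : (1 : ℝ) ≤ N := by exact_mod_cast h
    have h2 : ‖(T ^ N) x‖ * N ≤ (4 * C ^ 2 * √N * ‖x‖) * N := by
      refine h1.trans ?_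
      have : 0 ≤ 2 * C ^ 2 * √N * ‖x‖ := by positivity
      nlinarith
    have h3 := le_of_mul_le_mul_right h2 (by linarith)
    refine h3.trans ?_
    apply mul_le_mul_of_nonneg_right _ (norm_nonneg x)
    have h4 : √(N : ℝ) ≤ √((N : ℝ) + 1) := Real.sqrt_le_sqrt (by linarith)
    have h5 : 0 ≤ √(N : ℝ) := Real.sqrt_nonneg _
    nlinarith [sq_nonneg C]

lemma log_bound (T : H →L[ℂ] H) (C : ℝ)
    (hC : ∀ (n : ℕ) (x : H), ∑ j ∈ Finset.range n, ‖(T ^ j) x‖ ≤ C * n * ‖x‖) (hC0 : 0 < C)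
    (N : ℕ) (hN : 2 ≤ N) (x : H) :
    ‖(T ^ N) x‖ ≤ 8 * C ^ 2 * (4 * C ^ 2 + 1) * √N / √(harm (N / 2)) * ‖x‖ := by
  obtain ⟨m, hm⟩ : ∃ m, m = N / 2 := ⟨_, rfl⟩
  rw [← hm]
  have hm0 : 0 < m := by omega
  have hm' : (1 : ℝ) ≤ m := by exact_mod_cast hm0
  obtain ⟨D, hD⟩ : ∃ D, D = 4 * C ^ 2 + 1 := ⟨_, rfl⟩
  rw [← hD]
  have hD0 : 0 < D := by rw [hD]; positivity
  have hh := harm_pos m hm0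
  obtain ⟨g, hg⟩ : ∃ g, g = √(harm m) := ⟨_, rfl⟩
  have hg0 : 0 < g := by rw [hg]; exact Real.sqrt_pos.mpr hh
  have hg2 : g ^ 2 = harm m := by rw [hg, Real.sq_sqrt hh.le]
  have h1 := core_bound T C hC hC0 N m m hm0 hm0 (by omega)
    (fun l => 1 / (g * √((l : ℝ) + 1))) (fun l => 1 / (D * √((l : ℝ) + 1)))
    (fun l => by positivity) (fun l => by positivity)
    (by
      have : ∀ l ∈ Finset.range m, (1 / (g * √((l : ℝ) + 1))) ^ 2
          = 1 / g ^ 2 * (1 / ((l : ℝ) + 1)) := by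
        intro l _
        rw [div_pow, mul_pow, Real.sq_sqrt (by positivity)]
        field_simp
      rw [Finset.sum_congr rfl this, ← Finset.mul_sum]
      change 1 / g ^ 2 * harm m ≤ 1
      rw [hg2]
      exact (by field_simp : 1 / harm m * harm m = 1).le)
    (fun l z => by
      have := sqrt_bound T C hC hC0 l z
      rw [← hD] at this
      rw [div_mul_eq_mul_div, one_mul, div_le_iff₀ (by positivity)]
      linarith) x
  have hS : ∑ l ∈ Finset.range m, (1 / (g * √((l : ℝ) + 1))) * (1 / (D * √((l : ℝ) + 1)))
      = g / D := by
    have : ∀ l ∈ Finset.range m, (1 / (g * √((l : ℝ) + 1))) * (1 / (D * √((l : ℝ) + 1)))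
          = 1 / (g * D) * (1 / ((l : ℝ) + 1)) := by
      intro l _
      rw [div_mul_div_comm, div_mul_div_comm, mul_mul_mul_comm,
        Real.mul_self_sqrt (by positivity)]
    rw [Finset.sum_congr rfl this, ← Finset.mul_sum]
    change 1 / (g * D) * harm m = _
    rw [← hg2]
    field_simp
  rw [hS] at h1
  have hNm : (N : ℝ) + 1 ≤ 4 * m := by
    have : N + 1 ≤ 4 * m := by omega
    exact_mod_cast this
  have hmN : √(m : ℝ) ≤ √(N : ℝ) := by
    apply Real.sqrt_le_sqrt
    have : m ≤ N := by omega
    exact_mod_cast this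
  have h2 : (‖(T ^ N) x‖ * (g / D)) * m ≤ (8 * C ^ 2 * √N * ‖x‖) * m := by
    refine h1.trans ?_
    calc 2 * C ^ 2 * ((N : ℝ) + 1) * √m * ‖x‖ ≤ 2 * C ^ 2 * (4 * m) * √N * ‖x‖ := by gcongr
      _ = _ := by ring
  have h3 := le_of_mul_le_mul_right h2 (by linarith)
  rw [← hg]
  have h4 : ‖(T ^ N) x‖ = (‖(T ^ N) x‖ * (g / D)) * (D / g) := by field_simp
  rw [h4]
  refine (mul_le_mul_of_nonneg_right h3 (by positivity)).trans (le_of_eq ?_)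
  field_simp

end Rad

section Kernel

lemma cesKernel_pos (α : ℝ) (hα : 0 < α) (n : ℕ) : 0 < cesKernel α n := by
  unfold cesKernel
  have h1 := Real.Gamma_pos_of_pos (show 0 < α + n by positivity)
  have h2 := Real.Gamma_pos_of_pos hα
  have h3 := Real.Gamma_pos_of_pos (show (0 : ℝ) < n + 1 by positivity)
  positivity

lemma cesKernel_zero (α : ℝ) (hα : 0 < α) : cesKernel α 0 = 1 := by
  unfold cesKernel
  have h2 := Real.Gamma_pos_of_pos hα
  simp [h2.ne']

lemma cesKernel_succ (α : ℝ) (hα : 0 < α) (n : ℕ) :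
    cesKernel α (n + 1) = cesKernel α n * ((α + n) / (n + 1)) := by
  unfold cesKernel
  have h2 := Real.Gamma_pos_of_pos hα
  have h3 := Real.Gamma_pos_of_pos (show (0 : ℝ) < n + 1 by positivity)
  have h4 : (0 : ℝ) < n + 1 := by positivity
  push_cast
  rw [← add_assoc, Real.Gamma_add_one (show α + n ≠ 0 by positivity),
    Real.Gamma_add_one h4.ne']
  field_simp

lemma cesKernel_add_one (α : ℝ) (hα : 0 < α) (n : ℕ) :
    cesKernel (α + 1) n = cesKernel α n * ((α + n) / α) := by
  unfold cesKernel
  have h2 := Real.Gamma_pos_of_pos hα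
  have h3 := Real.Gamma_pos_of_pos (show (0 : ℝ) < n + 1 by positivity)
  rw [show α + 1 + (n : ℝ) = α + n + 1 by ring,
    Real.Gamma_add_one (show α + n ≠ 0 by positivity), Real.Gamma_add_one hα.ne']
  field_simp

lemma cesKernel_antitone (α : ℝ) (hα : 0 < α) (hα1 : α ≤ 1) : Antitone (cesKernel α) := by
  apply antitone_nat_of_succ_le
  intro n
  rw [cesKernel_succ α hα]
  apply mul_le_of_le_one_right (cesKernel_pos α hα n).le
  rw [div_le_one (by positivity)]
  linarith

lemma cesKernel_le (α : ℝ) (hα : 0 < α) (hα1 : α ≤ 1) (n : ℕ) :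
    cesKernel (α + 1) n ≤ ((n + α) / α) ^ α := by
  induction n with
  | zero => rw [cesKernel_zero _ (by linarith)]; simp [hα.ne']
  | succ n ih =>
    rw [cesKernel_succ _ (by linarith)]
    push_cast
    have hn : (0 : ℝ) ≤ n := n.cast_nonneg
    -- Bernoulli
    have hb := rpow_one_add_le_one_add_mul_self (s := -(1 / ((n : ℝ) + 1 + α)))
      (by rw [neg_le_neg_iff, div_le_one (by positivity)]; linarith) hα.le hα1
    have e1 : 1 + -(1 / ((n : ℝ) + 1 + α)) = ((n + α) / α) / ((n + 1 + α) / α) := by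
      field_simp; ring
    have e2 : 1 + α * -(1 / ((n : ℝ) + 1 + α)) = (n + 1) / (n + 1 + α) := by
      field_simp; ring
    rw [e1, e2, Real.div_rpow (by positivity) (by positivity), div_le_iff₀ (by positivity)] at hb
    calc cesKernel (α + 1) n * ((α + 1 + n) / (n + 1))
        ≤ ((n + 1) / (n + 1 + α) * ((n + 1 + α) / α) ^ α) * ((α + 1 + n) / (n + 1)) :=
          mul_le_mul_of_nonneg_right (ih.trans hb) (by positivity)
      _ = _ := by field_simp; ring

end Kernel

section Final
variable {H : Type*} [NormedAddCommGroup H] [InnerProductSpace ℂ H]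

lemma abs_sum_bound (α : ℝ) (hα0 : 0 < α) (T : H →L[ℂ] H) (C : ℝ)
    (hC : ∀ (n : ℕ) (x : H), (cesKernel (α + 1) n)⁻¹ *
      ∑ j ∈ Finset.range (n + 1), cesKernel α (n - j) * ‖(T ^ j) x‖ ≤ C * ‖x‖) (n : ℕ) (x : H) :
    ∑ j ∈ Finset.range (n + 1), cesKernel α (n - j) * ‖(T ^ j) x‖
      ≤ C * cesKernel (α + 1) n * ‖x‖ := by
  have h := hC n x
  have hk := cesKernel_pos (α + 1) (by linarith) n
  rw [inv_mul_le_iff₀ hk] at h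
  linarith

lemma abs_cesaro_one (α : ℝ) (hα0 : 0 < α) (hα1 : α ≤ 1) (T : H →L[ℂ] H) (C : ℝ) (hC0 : 0 < C)
    (hC : ∀ (n : ℕ) (x : H), (cesKernel (α + 1) n)⁻¹ *
      ∑ j ∈ Finset.range (n + 1), cesKernel α (n - j) * ‖(T ^ j) x‖ ≤ C * ‖x‖) (n : ℕ) (x : H) :
    ∑ j ∈ Finset.range n, ‖(T ^ j) x‖ ≤ C / α * n * ‖x‖ := by
  cases n with
  | zero => simp
  | succ n =>
    have h := abs_sum_bound α hα0 T C hC n x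
    have hk := cesKernel_pos α hα0 n
    rw [cesKernel_add_one α hα0] at h
    have h1 : cesKernel α n * ∑ j ∈ Finset.range (n + 1), ‖(T ^ j) x‖
        ≤ ∑ j ∈ Finset.range (n + 1), cesKernel α (n - j) * ‖(T ^ j) x‖ := by
      rw [Finset.mul_sum]
      apply Finset.sum_le_sum
      intro j _
      exact mul_le_mul_of_nonneg_right (cesKernel_antitone α hα0 hα1 (Nat.sub_le n j))
        (norm_nonneg _)
    have h2 : cesKernel α n * ∑ j ∈ Finset.range (n + 1), ‖(T ^ j) x‖
        ≤ cesKernel α n * (C / α * (α + n) * ‖x‖) :=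
      (h1.trans h).trans (le_of_eq (by ring))
    refine (le_of_mul_le_mul_left h2 hk).trans ?_
    push_cast
    rw [add_comm α]
    gcongr

lemma alpha_bound (α : ℝ) (hα0 : 0 < α) (hα1 : α ≤ 1) (T : H →L[ℂ] H) (C : ℝ) (hC0 : 0 < C)
    (hC : ∀ (n : ℕ) (x : H), (cesKernel (α + 1) n)⁻¹ *
      ∑ j ∈ Finset.range (n + 1), cesKernel α (n - j) * ‖(T ^ j) x‖ ≤ C * ‖x‖) (n : ℕ)
    (hn : 0 < n) (x : H) :
    ‖(T ^ n) x‖ ≤ C ^ 2 / α * ((1 + α) / α) ^ α * (n : ℝ) ^ α / harm (n + 1) * ‖x‖ := by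
  have hS := abs_sum_bound α hα0 T C hC
  have hgrow : ∀ (i : ℕ) (z : H), ‖(T ^ i) z‖ ≤ C * cesKernel (α + 1) i * ‖z‖ := by
    intro i z
    refine le_trans ?_ (hS i z)
    have := Finset.single_le_sum (f := fun j => cesKernel α (i - j) * ‖(T ^ j) z‖)
      (fun j _ => mul_nonneg (cesKernel_pos α hα0 _).le (norm_nonneg _))
      (Finset.self_mem_range_succ i)
    simpa [cesKernel_zero α hα0] using this
  have hh := harm_pos (n + 1) (by omega)
  have h1 : ‖(T ^ n) x‖ * (α / C) * harm (n + 1)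
      ≤ ∑ j ∈ Finset.range (n + 1), cesKernel α (n - j) * ‖(T ^ j) x‖ := by
    rw [← Finset.sum_range_reflect]
    unfold harm
    rw [Finset.mul_sum]
    apply Finset.sum_le_sum
    intro i hi
    rw [Finset.mem_range] at hi
    have e1 : n + 1 - 1 - i = n - i := by omega
    have e2 : n - (n - i) = i := by omega
    rw [e1, e2]
    have hk := cesKernel_pos α hα0 i
    have h3 := hgrow i ((T ^ (n - i)) x)
    have e3 : (T ^ i) ((T ^ (n - i)) x) = (T ^ n) x := by
      have : T ^ n = T ^ i * T ^ (n - i) := by rw [← pow_add]; congr 1; omega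
      rw [this]; rfl
    rw [e3, cesKernel_add_one α hα0] at h3
    calc ‖(T ^ n) x‖ * (α / C) * (1 / ((i : ℝ) + 1))
        ≤ (C * (cesKernel α i * ((α + i) / α)) * ‖(T ^ (n - i)) x‖) * (α / C)
            * (1 / ((i : ℝ) + 1)) := by gcongr
      _ = (cesKernel α i * ‖(T ^ (n - i)) x‖) * ((α + i) / (i + 1)) := by field_simp
      _ ≤ (cesKernel α i * ‖(T ^ (n - i)) x‖) * 1 := by
          apply mul_le_mul_of_nonneg_left _ (by positivity)
          rw [div_le_one (by positivity)]
          linarith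
      _ = _ := mul_one _
  have hn' : (1 : ℝ) ≤ n := by exact_mod_cast hn
  have h4 : cesKernel (α + 1) n ≤ ((1 + α) / α) ^ α * (n : ℝ) ^ α := by
    refine (cesKernel_le α hα0 hα1 n).trans ?_
    rw [← Real.mul_rpow (by positivity) (by positivity)]
    apply Real.rpow_le_rpow (by positivity) _ hα0.le
    rw [div_mul_eq_mul_div]
    gcongr
    nlinarith
  have h5 : ‖(T ^ n) x‖ * (α / C) * harm (n + 1)
      ≤ C * (((1 + α) / α) ^ α * (n : ℝ) ^ α) * ‖x‖ :=
    (h1.trans (hS n x)).trans (by gcongr)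
  have h6 : ‖(T ^ n) x‖ = (‖(T ^ n) x‖ * (α / C) * harm (n + 1)) * (C / (α * harm (n + 1))) := by
    field_simp
  rw [h6]
  refine (mul_le_mul_of_nonneg_right h5 (by positivity)).trans (le_of_eq ?_)
  field_simp

end Final

/-- Let `H` be a complex Hilbert space, `0 < α ≤ 1` and `T` absolutely `(C,α)`-Cesàro
bounded on `H`. Then `‖T^n‖ / n^{min(α,1/2)} → 0`. -/
theorem stmt10 {H : Type*} [NormedAddCommGroup H] [InnerProductSpace ℂ H] [CompleteSpace H]
    (α : ℝ) (hα0 : 0 < α) (hα1 : α ≤ 1) (T : H →L[ℂ] H) (hT : AbsCesaroBounded α T) :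
    Tendsto (fun n : ℕ => ‖T ^ n‖ / (n : ℝ) ^ (min α (1 / 2))) atTop (nhds 0) := by
  obtain ⟨C, hC0, hC⟩ := hT
  rcases le_total α (1 / 2) with h | h
  · rw [min_eq_left h]
    have hlim : Tendsto (fun n : ℕ => (C ^ 2 / α * ((1 + α) / α) ^ α) / harm (n + 1)) atTop
        (nhds 0) :=
      (harm_tendsto.comp (tendsto_add_atTop_nat 1)).const_div_atTop _
    refine squeeze_zero' (Eventually.of_forall fun n => by positivity) ?_ hlim
    filter_upwards [eventually_ge_atTop 1] with n hn
    have hn' : (0 : ℝ) < n := by exact_mod_cast hn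
    have hh := harm_pos (n + 1) (by omega)
    rw [div_le_iff₀ (Real.rpow_pos_of_pos hn' _)]
    apply ContinuousLinearMap.opNorm_le_bound _ (by positivity)
    intro x
    refine (alpha_bound α hα0 hα1 T C hC0 hC n hn x).trans (le_of_eq ?_)
    ring
  · rw [min_eq_right h]
    have hC' := abs_cesaro_one α hα0 hα1 T C hC0 hC
    have hC0' : 0 < C / α := by positivity
    obtain ⟨E, hE⟩ : ∃ E, E = C / α := ⟨_, rfl⟩
    rw [← hE] at hC0'
    simp only [← hE] at hC'
    have hlim : Tendsto (fun n : ℕ => (8 * E ^ 2 * (4 * E ^ 2 + 1)) / √(harm (n / 2))) atTop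
        (nhds 0) :=
      (Real.tendsto_sqrt_atTop.comp (harm_tendsto.comp
        (Nat.tendsto_div_const_atTop (by norm_num)))).const_div_atTop _
    refine squeeze_zero' (Eventually.of_forall fun n => by positivity) ?_ hlim
    filter_upwards [eventually_ge_atTop 2] with n hn
    have hn' : (0 : ℝ) < n := by
      have : 0 < n := by omega
      exact_mod_cast this
    rw [div_le_iff₀ (Real.rpow_pos_of_pos hn' _), ← Real.sqrt_eq_rpow]
    apply ContinuousLinearMap.opNorm_le_bound _ (by positivity)
    intro x
    refine (log_bound T E hC' hC0' n hn x).trans (le_of_eq ?_)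
    ring
end

section
/- Let α ≥ 2 and let T be a Kreiss bounded operator on a complex Banach space X. Then ‖M_T^α(n+1) − M_T^α(n)‖ → 0 as n → ∞. -/
open Filter
open scoped ENNReal

/-- `T` is Kreiss bounded: there is `C > 0` such that every `λ ∈ ℂ` with `|λ| > 1` lies in
the resolvent set of `T` and `‖(λ - T)⁻¹‖ ≤ C/(|λ| - 1)`. -/
def KreissBounded {X : Type*} [NormedAddCommGroup X] [NormedSpace ℂ X] [CompleteSpace X]
    (T : X →L[ℂ] X) : Prop :=
  ∃ C : ℝ, 0 < C ∧ ∀ lam : ℂ, 1 < ‖lam‖ →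
    lam ∈ resolventSet ℂ T ∧
      ‖Ring.inverse (algebraMap ℂ (X →L[ℂ] X) lam - T)‖ ≤ C / (‖lam‖ - 1)

theorem inv_bound {X : Type*} [NormedAddCommGroup X] [NormedSpace ℂ X] 
    (T : X →L[ℂ] X) (C : ℝ) (h : ∀ lam : ℂ, 1 < ‖lam‖ →
    lam ∈ resolventSet ℂ T ∧
      ‖Ring.inverse (algebraMap ℂ (X →L[ℂ] X) lam - T)‖ ≤ C / (‖lam‖ - 1)) (z : ℂ) (hz0 : z ≠ 0) (hz : ‖z‖ < 1) :
    ‖Ring.inverse (1 - z • T)‖ ≤ C / (1 - ‖z‖) := by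
  have hp : 0 < ‖z‖ := norm_pos_iff.2 hz0
  obtain ⟨h1, h2⟩ := h z⁻¹ (by rw [norm_inv]; exact (one_lt_inv₀ hp).2 hz)
  have e : (1 - z • T) = (algebraMap ℂ (X →L[ℂ] X) z) * (algebraMap ℂ (X →L[ℂ] X) z⁻¹ - T) := by
    rw [mul_sub, ← map_mul, mul_inv_cancel₀ hz0, map_one, ← Algebra.smul_def]
  have e2 : Ring.inverse (1 - z • T) = z⁻¹ • Ring.inverse (algebraMap ℂ (X →L[ℂ] X) z⁻¹ - T) := by
    obtain ⟨u, hu⟩ := h1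
    have hv : IsUnit (algebraMap ℂ (X →L[ℂ] X) z) := (IsUnit.mk0 z hz0).map _
    rw [e, Ring.mul_inverse_rev' (Algebra.commute_algebraMap_left z _)]
    rw [Algebra.smul_def, Algebra.commutes]
    congr 1
    have := Ring.inverse_mul_cancel _ hv
    have h3 : algebraMap ℂ (X →L[ℂ] X) z * algebraMap ℂ (X →L[ℂ] X) z⁻¹ = 1 := by
      rw [← map_mul, mul_inv_cancel₀ hz0, map_one]
    calc _ = Ring.inverse (algebraMap ℂ (X →L[ℂ] X) z) * (algebraMap ℂ (X →L[ℂ] X) z * algebraMap ℂ (X →L[ℂ] X) z⁻¹) := by rw [h3, mul_one]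
      _ = _ := by rw [← mul_assoc, this, one_mul]
  rw [e2, norm_smul, norm_inv]
  rw [norm_inv] at h2
  calc _ ≤ ‖z‖⁻¹ * (C / (‖z‖⁻¹ - 1)) := by gcongr
    _ = _ := by
      have : 1 - ‖z‖ ≠ 0 := by linarith
      have : ‖z‖⁻¹ - 1 ≠ 0 := by
        have := (one_lt_inv₀ hp).2 hz
        linarith
      field_simp

theorem pow_cauchy {X : Type*} [NormedAddCommGroup X] [NormedSpace ℂ X] [CompleteSpace X]
    (T : X →L[ℂ] X) (h : ∀ lam : ℂ, 1 < ‖lam‖ → lam ∈ resolventSet ℂ T) (r : NNReal) (hr0 : 0 < r) (hr : r < 1) :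
    DifferentiableOn ℂ (fun z : ℂ => Ring.inverse (1 - z • T)) (Metric.closedBall 0 r) ∧ 
    ∀ n, T ^ n = (2 * Real.pi * Complex.I : ℂ)⁻¹ •
      ∮ z in C(0, r), (1 / z) ^ n • z⁻¹ • Ring.inverse (1 - z • T) := by
  have hs : spectralRadius ℂ T ≤ 1 := by
    refine iSup₂_le fun k hk => ?_
    by_contra hh
    push Not at hh
    exact hk (h k (by exact_mod_cast hh))
  have hd := spectrum.differentiableOn_inverse_one_sub_smul (𝕜 := ℂ) (a := T) (r := r)
    (lt_of_lt_of_le (by exact_mod_cast hr) (ENNReal.one_le_inv.2 hs))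
  refine ⟨hd, fun n => ?_⟩
  have h1 := (hd.hasFPowerSeriesOnBall hr0).hasFPowerSeriesAt
  have h2 := (spectrum.hasFPowerSeriesOnBall_inverse_one_sub_smul ℂ T).hasFPowerSeriesAt
  have h3 := h2.eq_formalMultilinearSeries h1
  have h4 := congrArg (fun p => p n (fun _ => (1:ℂ))) h3
  simp only [cauchyPowerSeries_apply] at h4
  simpa using h4

theorem parseval_fin (N : ℕ) (a : ℕ → ℝ) :
    ∫ t in (0:ℝ)..(2 * Real.pi), ‖∑ j ∈ Finset.range N, (a j : ℂ) * Complex.exp (-(j * t * Complex.I))‖ ^ 2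
      = 2 * Real.pi * ∑ j ∈ Finset.range N, a j ^ 2 := by
  apply Complex.ofReal_injective
  rw [← intervalIntegral.integral_ofReal]
  have e : ∀ t : ℝ, ((‖∑ j ∈ Finset.range N, (a j : ℂ) * Complex.exp (-(j * t * Complex.I))‖ ^ 2 : ℝ) : ℂ)
      = ∑ j ∈ Finset.range N, ∑ k ∈ Finset.range N, ((a j * a k : ℂ) * Complex.exp ((((j : ℂ) - k) * Complex.I) * t)) := by
    intro t
    push_cast
    rw [← Complex.conj_mul', map_sum, Finset.sum_mul_sum]
    refine Finset.sum_congr rfl fun j _ => Finset.sum_congr rfl fun k _ => ?_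
    rw [map_mul, Complex.conj_ofReal, ← Complex.exp_conj, mul_mul_mul_comm, ← Complex.exp_add]
    congr 2
    simp
    ring
  simp_rw [e]
  have hint : ∀ j k : ℕ, ∫ t in (0:ℝ)..(2 * Real.pi), ((a j * a k : ℂ) * Complex.exp ((((j : ℂ) - k) * Complex.I) * t))
      = if j = k then 2 * Real.pi * (a j : ℂ) ^ 2 else 0 := by
    intro j k
    rw [intervalIntegral.integral_const_mul]
    split_ifs with h
    · subst h; simp; ring
    · have hc : ((j : ℂ) - k) * Complex.I ≠ 0 := by
        refine mul_ne_zero (sub_ne_zero.2 ?_) Complex.I_ne_zero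
        exact_mod_cast h
      rw [integral_exp_mul_complex hc]
      have : Complex.exp (((j : ℂ) - k) * Complex.I * ((2 * Real.pi : ℝ) : ℂ)) = 1 := by
        have := Complex.exp_int_mul_two_pi_mul_I ((j : ℤ) - k)
        rw [← this]
        congr 1
        push_cast
        ring
      rw [this]
      simp
  rw [intervalIntegral.integral_finsetSum]
  · have : ∀ j ∈ Finset.range N, ∫ t in (0:ℝ)..(2 * Real.pi), ∑ k ∈ Finset.range N, ((a j * a k : ℂ) * Complex.exp ((((j : ℂ) - k) * Complex.I) * t)) = 2 * Real.pi * (a j : ℂ) ^ 2 := by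
      intro j hj
      rw [intervalIntegral.integral_finsetSum]
      · simp_rw [hint]
        rw [Finset.sum_ite_eq, if_pos hj]
      · intro k _
        exact Continuous.intervalIntegrable (by fun_prop) _ _
    rw [Finset.sum_congr rfl this, ← Finset.mul_sum]
    push_cast
    rfl
  · intro k _
    exact Continuous.intervalIntegrable (by fun_prop) _ _

theorem sum_pow_bound {X : Type*} [NormedAddCommGroup X] [NormedSpace ℂ X] [CompleteSpace X]
    (T : X →L[ℂ] X) (C : ℝ) (hC : 0 < C) (h : ∀ lam : ℂ, 1 < ‖lam‖ →
    lam ∈ resolventSet ℂ T ∧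
      ‖Ring.inverse (algebraMap ℂ (X →L[ℂ] X) lam - T)‖ ≤ C / (‖lam‖ - 1)) (N : ℕ) (r : ℝ) (hr0 : 0 < r) (hr1 : r < 1)
    (s : ℝ) (hs : 0 < s) :
    ‖∑ j ∈ Finset.range N, T ^ j‖ ≤ C / (1 - r) * (((∑ j ∈ Finset.range N, (r⁻¹ ^ j) ^ 2) / s + s) / 2) := by
  obtain ⟨hd, hp⟩ := pow_cauchy T (fun l hl => (h l hl).1) ⟨r, hr0.le⟩ hr0 hr1
  change DifferentiableOn ℂ (fun z : ℂ => Ring.inverse (1 - z • T)) (Metric.closedBall 0 r) at hd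
  change ∀ n, T ^ n = (2 * Real.pi * Complex.I : ℂ)⁻¹ •
      ∮ z in C(0, r), (1 / z) ^ n • z⁻¹ • Ring.inverse (1 - z • T) at hp
  have hcm : ∀ t : ℝ, circleMap 0 r t ≠ 0 := fun t => circleMap_ne_center hr0.ne'
  have hcf : Continuous fun t : ℝ => Ring.inverse (1 - circleMap 0 r t • T) := by
    refine hd.continuousOn.comp_continuous (continuous_circleMap 0 r) fun t => ?_
    exact circleMap_mem_closedBall 0 hr0.le t
  have hci : Continuous fun t : ℝ => (circleMap 0 r t)⁻¹ := (continuous_circleMap 0 r).inv₀ hcm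
  set D : ℝ → ℂ := fun t => ∑ j ∈ Finset.range N, ((r⁻¹ ^ j : ℝ) : ℂ) * Complex.exp (-(j * t * Complex.I)) with hD
  have hDc : Continuous D := by fun_prop
  have key : ∑ j ∈ Finset.range N, T ^ j = (2 * Real.pi * Complex.I : ℂ)⁻¹ •
      ∫ t in (0:ℝ)..(2 * Real.pi), (Complex.I * D t) • Ring.inverse (1 - circleMap 0 r t • T) := by
    rw [Finset.sum_congr rfl fun j _ => hp j, ← Finset.smul_sum]
    congr 1
    simp only [circleIntegral]
    rw [← intervalIntegral.integral_finsetSum]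
    · refine intervalIntegral.integral_congr fun t _ => ?_
      simp only [hD, smul_smul, ← Finset.sum_smul, Finset.mul_sum]
      congr 1
      refine Finset.sum_congr rfl fun j _ => ?_
      rw [deriv_circleMap]
      have h1 : (1 / circleMap 0 r t) ^ j = ((r⁻¹ ^ j : ℝ) : ℂ) * Complex.exp (-(j * t * Complex.I)) := by
        rw [circleMap_zero, one_div, mul_inv, mul_pow, ← Complex.exp_neg, ← Complex.exp_nat_mul]
        push_cast
        congr 2
        ring
      rw [h1]
      have := hcm t
      field_simp
    · intro j _
      refine Continuous.intervalIntegrable ?_ _ _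
      simp only [deriv_circleMap, one_div]
      have := continuous_circleMap 0 r
      fun_prop
  have hr1' : 0 < 1 - r := by linarith
  have hbd : ∀ t : ℝ, ‖(Complex.I * D t) • Ring.inverse (1 - circleMap 0 r t • T)‖ ≤
      C / (1 - r) * ((‖D t‖ ^ 2 / s + s) / 2) := by
    intro t
    have h1 := inv_bound T C h (circleMap 0 r t) (hcm t) (by rw [norm_circleMap_zero, abs_of_pos hr0]; exact hr1)
    rw [norm_circleMap_zero, abs_of_pos hr0] at h1
    have h2 : ‖D t‖ ≤ (‖D t‖ ^ 2 / s + s) / 2 := by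
      have : 0 ≤ (‖D t‖ - s) ^ 2 / s := by positivity
      have e : (‖D t‖ - s) ^ 2 / s = ‖D t‖ ^ 2 / s + s - 2 * ‖D t‖ := by field_simp; ring
      linarith
    rw [norm_smul, norm_mul, Complex.norm_I, one_mul, mul_comm]
    gcongr
  rw [key, norm_smul]
  have h3 := intervalIntegral.norm_integral_le_of_norm_le (a := 0) (b := 2 * Real.pi) (μ := MeasureTheory.volume)
    Real.two_pi_pos.le (Filter.Eventually.of_forall fun t _ => hbd t)
    (Continuous.intervalIntegrable (by fun_prop) _ _)
  have h4 : ∫ t in (0:ℝ)..(2 * Real.pi), C / (1 - r) * ((‖D t‖ ^ 2 / s + s) / 2) =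
      2 * Real.pi * (C / (1 - r) * (((∑ j ∈ Finset.range N, (r⁻¹ ^ j) ^ 2) / s + s) / 2)) := by
    rw [intervalIntegral.integral_const_mul, intervalIntegral.integral_div, intervalIntegral.integral_add,
      intervalIntegral.integral_div, parseval_fin]
    · simp; ring
    · exact Continuous.intervalIntegrable (by fun_prop) _ _
    · exact Continuous.intervalIntegrable (by fun_prop) _ _
  rw [h4] at h3
  have h5 : ‖(2 * Real.pi * Complex.I : ℂ)⁻¹‖ = (2 * Real.pi)⁻¹ := by
    simp [abs_of_pos Real.pi_pos]
  rw [h5]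
  refine (mul_le_mul_of_nonneg_left h3 (by positivity)).trans_eq ?_
  have := Real.pi_pos.ne'
  field_simp

theorem sum_pow_bound2 {X : Type*} [NormedAddCommGroup X] [NormedSpace ℂ X] [CompleteSpace X]
    (T : X →L[ℂ] X) (C : ℝ) (hC : 0 < C) (h : ∀ lam : ℂ, 1 < ‖lam‖ →
    lam ∈ resolventSet ℂ T ∧
      ‖Ring.inverse (algebraMap ℂ (X →L[ℂ] X) lam - T)‖ ≤ C / (‖lam‖ - 1)) (N : ℕ) (hN : 0 < N) :
    ‖∑ j ∈ Finset.range N, T ^ j‖ ≤ 10 * C * N * √N := by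
  have hN' : (1:ℝ) ≤ N := by exact_mod_cast hN
  have hN0 : (0:ℝ) < N := by linarith
  have hs : 0 < √(N:ℝ) := Real.sqrt_pos.2 hN0
  have h1 := sum_pow_bound T C hC h N (N / (N + 1)) (by positivity) ((div_lt_one (by positivity)).2 (by linarith)) (√N) hs
  refine h1.trans ?_
  have h2 : ∑ j ∈ Finset.range N, (((N:ℝ) / (N + 1))⁻¹ ^ j) ^ 2 ≤ N * 9 := by
    have : ∀ j ∈ Finset.range N, (((N:ℝ) / (N + 1))⁻¹ ^ j) ^ 2 ≤ 9 := by
      intro j hj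
      have e : ((N:ℝ) / (N + 1))⁻¹ = 1 + 1 / N := by field_simp
      have h3 : (1 + 1 / (N:ℝ)) ^ j ≤ 3 := by
        calc (1 + 1 / (N:ℝ)) ^ j ≤ (1 + 1 / (N:ℝ)) ^ N := 
              pow_le_pow_right₀ (by simp) (Finset.mem_range.1 hj).le
          _ ≤ (Real.exp (1 / N)) ^ N := by
              gcongr
              rw [add_comm]
              exact Real.add_one_le_exp _
          _ = Real.exp 1 := by
              rw [← Real.exp_nat_mul]
              congr 1
              field_simp
          _ ≤ 3 := Real.exp_one_lt_three.le
      rw [e]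
      have : 0 ≤ (1 + 1 / (N:ℝ)) ^ j := by positivity
      nlinarith
    simpa using Finset.sum_le_card_nsmul _ _ _ this
  have e1 : C / (1 - (N:ℝ) / (N + 1)) = C * (N + 1) := by field_simp; ring
  have e2 : (N:ℝ) / √N = √N := Real.div_sqrt
  calc _ ≤ C * (N + 1) * ((N * 9 / √N + √N) / 2) := by
        rw [e1]
        gcongr
    _ = C * (N + 1) * (5 * √N) := by
        rw [mul_comm (N:ℝ) 9, mul_div_assoc, e2]; ring
    _ ≤ C * (N + N) * (5 * √N) := by gcongr
    _ = _ := by ring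

theorem ker_pos (β : ℝ) (hβ : 0 < β) (n : ℕ) : 0 < cesKernel β n := by
  unfold cesKernel
  have h1 := Real.Gamma_pos_of_pos hβ
  have h2 := Real.Gamma_pos_of_pos (show 0 < β + n by positivity)
  have h3 := Real.Gamma_pos_of_pos (show 0 < (n:ℝ) + 1 by positivity)
  positivity

theorem ker_succ (β : ℝ) (hβ : 0 < β) (n : ℕ) :
    cesKernel β (n + 1) = cesKernel β n * ((β + n) / (n + 1)) := by
  unfold cesKernel
  have h1 := Real.Gamma_pos_of_pos hβ
  have h3 := Real.Gamma_pos_of_pos (show 0 < (n:ℝ) + 1 by positivity)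
  have e1 : Real.Gamma (β + ((n + 1 : ℕ) : ℝ)) = (β + n) * Real.Gamma (β + n) := by
    rw [← Real.Gamma_add_one (by positivity)]
    push_cast
    congr 1
    ring
  have e2 : Real.Gamma (((n + 1 : ℕ) : ℝ) + 1) = (n + 1) * Real.Gamma (n + 1) := by
    rw [← Real.Gamma_add_one (by positivity)]
    push_cast
    rfl
  rw [e1, e2]
  field_simp

theorem ker_ratio (β : ℝ) (hβ : 0 < β) (n : ℕ) :
    cesKernel β n = cesKernel (β + 1) n * (β / (β + n)) := by
  unfold cesKernel
  have h1 := Real.Gamma_pos_of_pos hβ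
  have h3 := Real.Gamma_pos_of_pos (show 0 < (n:ℝ) + 1 by positivity)
  have e1 : Real.Gamma (β + 1 + n) = (β + n) * Real.Gamma (β + n) := by
    rw [← Real.Gamma_add_one (by positivity)]
    congr 1
    ring
  rw [e1, Real.Gamma_add_one hβ.ne']
  have : 0 < β + n := by positivity
  field_simp

theorem ker_zero (β : ℝ) (hβ : 0 < β) : cesKernel β 0 = 1 := by
  unfold cesKernel
  have h1 := Real.Gamma_pos_of_pos hβ
  simp [h1.ne']

theorem ker_diff (β : ℝ) (hβ : 0 < β) (n : ℕ) :
    cesKernel (β + 1) (n + 1) = cesKernel (β + 1) n + cesKernel β (n + 1) := by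
  rw [ker_ratio β hβ (n + 1), ker_succ (β + 1) (by positivity) n]
  have : 0 < β + (n + 1) := by positivity
  have : 0 < β + 1 + n := by positivity
  push_cast
  field_simp
  ring

theorem ker_mono (β : ℝ) (hβ : 1 ≤ β) : Monotone (cesKernel β) := by
  refine monotone_nat_of_le_succ fun n => ?_
  rw [ker_succ β (by linarith)]
  refine le_mul_of_one_le_right (ker_pos β (by linarith) n).le ?_
  rw [one_le_div (by positivity)]
  linarith

theorem abel_bound {E : Type*} [NormedAddCommGroup E] [NormedSpace ℂ E] (v : ℕ → E) (w : ℕ → ℝ)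
    (hw : Antitone w) (B : ℝ) (m : ℕ)
    (hB : ∀ k ≤ m, ‖∑ j ∈ Finset.range k, v j‖ ≤ B) :
    ‖∑ j ∈ Finset.range (m + 1), (w j : ℂ) • v j - (w m : ℂ) • ∑ j ∈ Finset.range (m + 1), v j‖
      ≤ (w 0 - w m) * B := by
  induction m with
  | zero => simp
  | succ m ih =>
    have h1 := ih fun k hk => hB k (by omega)
    have h2 := hB (m + 1) le_rfl
    have hle := hw (Nat.le_succ m)
    have e : ∑ j ∈ Finset.range (m + 1 + 1), (w j : ℂ) • v j - (w (m + 1) : ℂ) • ∑ j ∈ Finset.range (m + 1 + 1), v j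
      = (∑ j ∈ Finset.range (m + 1), (w j : ℂ) • v j - (w m : ℂ) • ∑ j ∈ Finset.range (m + 1), v j)
        + ((w m - w (m + 1) : ℝ) : ℂ) • ∑ j ∈ Finset.range (m + 1), v j := by
      rw [Finset.sum_range_succ _ (m + 1), Finset.sum_range_succ _ (m + 1)]
      push_cast
      rw [smul_add, sub_smul]
      abel
    rw [e]
    refine (norm_add_le _ _).trans ?_
    rw [norm_smul, Complex.norm_real, Real.norm_of_nonneg (by linarith)]
    have : (w m - w (m + 1)) * ‖∑ j ∈ Finset.range (m + 1), v j‖ ≤ (w m - w (m + 1)) * B :=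
      mul_le_mul_of_nonneg_left h2 (by linarith)
    linarith

theorem ces_sum_bound {E : Type*} [NormedAddCommGroup E] [NormedSpace ℂ E] (v : ℕ → E) (β : ℝ)
    (hβ : 1 ≤ β) (B : ℝ) (n : ℕ)
    (hB : ∀ k ≤ n + 1, ‖∑ j ∈ Finset.range k, v j‖ ≤ B) :
    ‖∑ j ∈ Finset.range (n + 1), (cesKernel β (n - j) : ℂ) • v j‖ ≤ cesKernel β n * B := by
  have h1 := abel_bound v (fun j => cesKernel β (n - j))
    (fun i j hij => ker_mono β hβ (by omega)) B n (fun k hk => hB k (by omega))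
  have h2 := hB (n + 1) le_rfl
  simp only [Nat.sub_zero, Nat.sub_self] at h1
  have h3 := norm_add_le (∑ j ∈ Finset.range (n + 1), (cesKernel β (n - j) : ℂ) • v j -
    (cesKernel β 0 : ℂ) • ∑ j ∈ Finset.range (n + 1), v j)
    ((cesKernel β 0 : ℂ) • ∑ j ∈ Finset.range (n + 1), v j)
  rw [sub_add_cancel] at h3
  have h0 := ker_pos β (by linarith) 0
  have h4 : ‖(cesKernel β 0 : ℂ) • ∑ j ∈ Finset.range (n + 1), v j‖ ≤ cesKernel β 0 * B := by
    rw [norm_smul, Complex.norm_real, Real.norm_of_nonneg h0.le]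
    exact mul_le_mul_of_nonneg_left h2 h0.le
  linarith

theorem ces_sum_succ {E : Type*} [NormedAddCommGroup E] [NormedSpace ℂ E] (v : ℕ → E) (β : ℝ)
    (hβ : 0 < β) (n : ℕ) :
    ∑ j ∈ Finset.range (n + 1 + 1), (cesKernel (β + 1) (n + 1 - j) : ℂ) • v j =
      ∑ j ∈ Finset.range (n + 1), (cesKernel (β + 1) (n - j) : ℂ) • v j +
      ∑ j ∈ Finset.range (n + 1 + 1), (cesKernel β (n + 1 - j) : ℂ) • v j := by
  rw [Finset.sum_range_succ _ (n + 1), Finset.sum_range_succ _ (n + 1), ← add_assoc,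
    ← Finset.sum_add_distrib]
  congr 1
  · refine Finset.sum_congr rfl fun j hj => ?_
    have hj' := Finset.mem_range.1 hj
    rw [show n + 1 - j = (n - j) + 1 by omega, ker_diff β hβ, ← add_smul]
    push_cast
    rfl
  · simp [ker_zero β hβ, ker_zero (β + 1) (by linarith)]

theorem ces_diff_bound {X : Type*} [NormedAddCommGroup X] [NormedSpace ℂ X]
    (α : ℝ) (hα : 2 ≤ α) (T : X →L[ℂ] X) (n : ℕ) (B : ℝ)
    (hB : ∀ k ≤ n + 2, ‖∑ j ∈ Finset.range k, T ^ j‖ ≤ B) :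
    ‖cesMean α T (n + 1) - cesMean α T n‖ ≤ 2 * α ^ 2 / (n + 1) ^ 2 * B := by
  have hB0 : 0 ≤ B := (norm_nonneg _).trans (hB 0 (by omega))
  have hs := ces_sum_succ (fun j => T ^ j) (α - 1) (by linarith) n
  have b1 := ces_sum_bound (fun j => T ^ j) (α - 1) (by linarith) B (n + 1) hB
  have b2 := ces_sum_bound (fun j => T ^ j) α (by linarith) B n (fun k hk => hB k (by omega))
  rw [sub_add_cancel] at hs
  unfold cesMean
  rw [hs]
  set S := ∑ j ∈ Finset.range (n + 1), (cesKernel α (n - j) : ℂ) • T ^ j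
  set S' := ∑ j ∈ Finset.range (n + 1 + 1), (cesKernel (α - 1) (n + 1 - j) : ℂ) • T ^ j
  have p := ker_pos (α + 1) (by linarith) n
  have p' := ker_pos (α + 1) (by linarith) (n + 1)
  have r1 := ker_ratio (α - 1) (by linarith) (n + 1)
  rw [sub_add_cancel] at r1
  have r2 := ker_ratio α (by linarith) (n + 1)
  have r3 := ker_ratio α (by linarith) n
  have r4 := ker_succ (α + 1) (by linarith) n
  have hn : (0:ℝ) ≤ n := n.cast_nonneg
  have hKK : (cesKernel (α + 1) n)⁻¹ - (cesKernel (α + 1) (n + 1))⁻¹ =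
      (cesKernel (α + 1) n)⁻¹ * (α / (α + 1 + n)) := by
    rw [r4]
    have : 0 < α + 1 + n := by linarith
    field_simp
    ring
  have hle : 0 ≤ (cesKernel (α + 1) n)⁻¹ - (cesKernel (α + 1) (n + 1))⁻¹ := by
    rw [hKK]; positivity
  have c1 : (cesKernel (α + 1) (n + 1))⁻¹ * cesKernel (α - 1) (n + 1) ≤ α ^ 2 / (n + 1) ^ 2 := by
    rw [r1, r2]
    push_cast
    have e : (cesKernel (α + 1) (n + 1))⁻¹ * (cesKernel (α + 1) (n + 1) * (α / (α + (n + 1))) *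
      ((α - 1) / (α - 1 + (n + 1)))) = (α / (α + (n + 1))) * ((α - 1) / (α - 1 + (n + 1))) := by
      field_simp
    rw [e, ← div_pow, sq]
    have q : 0 ≤ α - 1 := by linarith
    exact mul_le_mul (div_le_div₀ (by linarith) (by linarith) (by linarith) (by linarith))
      (div_le_div₀ (by linarith) (by linarith) (by linarith) (by linarith))
      (div_nonneg (by linarith) (by linarith)) (div_nonneg (by linarith) (by linarith))
  have c2 : ((cesKernel (α + 1) n)⁻¹ - (cesKernel (α + 1) (n + 1))⁻¹) * cesKernel α n
      ≤ α ^ 2 / (n + 1) ^ 2 := by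
    rw [hKK, r3]
    have e : (cesKernel (α + 1) n)⁻¹ * (α / (α + 1 + n)) * (cesKernel (α + 1) n * (α / (α + n))) =
      (α / (α + 1 + n)) * (α / (α + n)) := by
      field_simp
    rw [e, ← div_pow, sq]
    exact mul_le_mul (div_le_div₀ (by linarith) (by linarith) (by linarith) (by linarith))
      (div_le_div₀ (by linarith) (by linarith) (by linarith) (by linarith))
      (div_nonneg (by linarith) (by linarith)) (div_nonneg (by linarith) (by linarith))
  have e : (((cesKernel (α + 1) (n + 1))⁻¹ : ℝ) : ℂ) • (S + S') - (((cesKernel (α + 1) n)⁻¹ : ℝ) : ℂ) • S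
      = (((cesKernel (α + 1) (n + 1))⁻¹ : ℝ) : ℂ) • S' -
        (((cesKernel (α + 1) n)⁻¹ - (cesKernel (α + 1) (n + 1))⁻¹ : ℝ) : ℂ) • S := by
    rw [Complex.ofReal_sub, sub_smul, smul_add]
    abel
  rw [e]
  refine (norm_sub_le _ _).trans ?_
  rw [norm_smul, norm_smul, Complex.norm_real, Complex.norm_real, Real.norm_of_nonneg hle,
    Real.norm_of_nonneg (inv_nonneg.2 p'.le)]
  have d1 := mul_le_mul_of_nonneg_left b1 (inv_nonneg.2 p'.le)
  have d2 := mul_le_mul_of_nonneg_left b2 hle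
  have d3 := mul_le_mul_of_nonneg_right c1 hB0
  have d4 := mul_le_mul_of_nonneg_right c2 hB0
  have e3 : 2 * α ^ 2 / ((n:ℝ) + 1) ^ 2 * B = α ^ 2 / (n + 1) ^ 2 * B + α ^ 2 / (n + 1) ^ 2 * B := by ring
  rw [e3]
  linarith

/-- Let `α ≥ 2` and `T` Kreiss bounded on a complex Banach space. Then
`‖M_T^α(n+1) - M_T^α(n)‖ → 0`. -/
theorem stmt15 {X : Type*} [NormedAddCommGroup X] [NormedSpace ℂ X] [CompleteSpace X]
    (α : ℝ) (hα : 2 ≤ α) (T : X →L[ℂ] X) (hT : KreissBounded T) :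
    Tendsto (fun n : ℕ => ‖cesMean α T (n + 1) - cesMean α T n‖) atTop (nhds 0) := by
  obtain ⟨C, hC, h⟩ := hT
  have hmain : ∀ n : ℕ, ‖cesMean α T (n + 1) - cesMean α T n‖ ≤
      80 * α ^ 2 * C * (√((n + 2 : ℕ) : ℝ))⁻¹ := by
    intro n
    have hb := ces_diff_bound α hα T n (10 * C * ((n + 2 : ℕ) : ℝ) * √((n + 2 : ℕ) : ℝ)) (by
      intro k hk
      rcases Nat.eq_zero_or_pos k with rfl | hk0
      · simp; positivity
      · refine (sum_pow_bound2 T C hC h k hk0).trans ?_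
        have : (k : ℝ) ≤ ((n + 2 : ℕ) : ℝ) := by exact_mod_cast hk
        gcongr)
    refine hb.trans ?_
    set s := √((n + 2 : ℕ) : ℝ) with hs
    have hs0 : 0 < s := Real.sqrt_pos.2 (by positivity)
    have hss : ((n + 2 : ℕ) : ℝ) = s ^ 2 := (Real.sq_sqrt (by positivity)).symm
    have hn : (0:ℝ) ≤ n := n.cast_nonneg
    have h2 : s ^ 2 ≤ 2 * ((n:ℝ) + 1) := by rw [← hss]; push_cast; linarith
    have h3 : s ^ 2 * s ^ 2 ≤ (2 * ((n:ℝ) + 1)) * (2 * ((n:ℝ) + 1)) := by gcongr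
    rw [hss]
    have e : 2 * α ^ 2 / ((n:ℝ) + 1) ^ 2 * (10 * C * s ^ 2 * s) =
        20 * α ^ 2 * C * s⁻¹ * (s ^ 2 * s ^ 2 / ((n:ℝ) + 1) ^ 2) := by
      field_simp
      norm_num
    have h4 : s ^ 2 * s ^ 2 / ((n:ℝ) + 1) ^ 2 ≤ 4 := by
      rw [div_le_iff₀ (by positivity)]
      linarith
    rw [e]
    calc _ ≤ 20 * α ^ 2 * C * s⁻¹ * 4 := by gcongr
      _ = _ := by ring
  refine squeeze_zero (fun n => norm_nonneg _) hmain ?_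
  have h1 : Tendsto (fun n : ℕ => (√((n + 2 : ℕ) : ℝ))⁻¹) atTop (nhds 0) := by
    refine tendsto_inv_atTop_zero.comp (Real.tendsto_sqrt_atTop.comp ?_)
    exact tendsto_natCast_atTop_atTop.comp (tendsto_add_atTop_nat 2)
  simpa using h1.const_mul (80 * α ^ 2 * C)
end
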